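/- arXiv:math/0103199 — 5 statements merged into one kernel-verified Lean document; each statement's English description precedes it below -/
import Mathlib

section
/- Let $f : X \to Y$ be a continuous map of compact metric spaces, and suppose every fiber $f^{-1}(y)$ has covering dimension at most $n$ and $Y$ has covering dimension at most $m$. Then $X$ has covering dimension at most $n + m$. -/
open Set Metric

def CovDimLE (X : Type*) [TopologicalSpace X] (n : ℕ) : Prop :=
  ∀ (ι : Type) (U : ι → Set X), (∀ i, IsOpen (U i)) → (⋃ i, U i) = Set.univ →
    ∃ (κ : Type) (V : κ → Set X),
      (∀ j, IsOpen (V j)) ∧ (⋃ j, V j) = Set.univ ∧ (∀ j, ∃ i, V j ⊆ U i) ∧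
      ∀ x : X, {j | x ∈ V j}.Finite ∧ {j | x ∈ V j}.ncard ≤ n + 1

open Topology Module

/-- `CovDimLE X n` with the order `n + 1` of the refinement replaced by `k`. -/
def CovOrderLE (X : Type*) [TopologicalSpace X] (k : ℕ) : Prop :=
  ∀ (ι : Type) (U : ι → Set X), (∀ i, IsOpen (U i)) → (⋃ i, U i) = Set.univ →
    ∃ (κ : Type) (V : κ → Set X),
      (∀ j, IsOpen (V j)) ∧ (⋃ j, V j) = Set.univ ∧ (∀ j, ∃ i, V j ⊆ U i) ∧
      ∀ x : X, {j | x ∈ V j}.Finite ∧ {j | x ∈ V j}.ncard ≤ k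

theorem CovOrderLE.mono {X : Type*} [TopologicalSpace X] {k l : ℕ} (h : CovOrderLE X k)
    (hkl : k ≤ l) : CovOrderLE X l := by
  intro ι U hU hc
  obtain ⟨κ, V, h1, h2, h3, h4⟩ := h ι U hU hc
  exact ⟨κ, V, h1, h2, h3, fun x => ⟨(h4 x).1, (h4 x).2.trans hkl⟩⟩

theorem CovOrderLE.isEmpty {X : Type*} [TopologicalSpace X] (h : CovOrderLE X 0) :
    IsEmpty X := by
  refine ⟨fun x => ?_⟩
  obtain ⟨κ, V, -, h2, -, h4⟩ := h Unit (fun _ => univ) (fun _ => isOpen_univ)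
    (iUnion_const univ)
  obtain ⟨j, hj⟩ := mem_iUnion.1 (h2.symm ▸ mem_univ x : x ∈ ⋃ j, V j)
  have h0 := (ncard_eq_zero (h4 x).1).1 (Nat.le_zero.1 (h4 x).2)
  exact (h0 ▸ (show j ∈ {j | x ∈ V j} from hj) : j ∈ (∅ : Set κ))

theorem CovOrderLE.of_homeomorph {X X' : Type*} [TopologicalSpace X] [TopologicalSpace X']
    {k : ℕ} (h : CovOrderLE X k) (e : X' ≃ₜ X) : CovOrderLE X' k := by
  intro ι U hU hc
  obtain ⟨κ, V, h1, h2, h3, h4⟩ := h ι (fun i => e.symm ⁻¹' U i)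
    (fun i => (hU i).preimage e.symm.continuous) (by rw [← preimage_iUnion, hc, preimage_univ])
  refine ⟨κ, fun j => e ⁻¹' V j, fun j => (h1 j).preimage e.continuous,
    by rw [← preimage_iUnion, h2, preimage_univ], fun j => ?_, fun x => h4 (e x)⟩
  obtain ⟨i, hi⟩ := h3 j
  exact ⟨i, fun x hx => by simpa using hi hx⟩

/-- In a compact space, the refinement may be taken finite, and the cover to be refined may be
indexed by a type in any universe. -/
theorem CovOrderLE.exists_finite_refinement {X : Type*} [TopologicalSpace X] [CompactSpace X]
    {k : ℕ} (h : CovOrderLE X k) {ι : Type*} (U : ι → Set X) (hU : ∀ i, IsOpen (U i))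
    (hc : (⋃ i, U i) = univ) :
    ∃ (κ : Type) (_ : Fintype κ) (V : κ → Set X), (∀ j, IsOpen (V j)) ∧ (⋃ j, V j) = univ ∧
      (∀ j, ∃ i, V j ⊆ U i) ∧ ∀ x : X, {j | x ∈ V j}.ncard ≤ k := by
  obtain ⟨t, ht⟩ := isCompact_univ.elim_finite_subcover U hU hc.ge
  obtain ⟨κ, V, h1, h2, h3, h4⟩ := h (Fin t.card) (fun i => U (t.equivFin.symm i))
    (fun i => hU _) (by
      refine eq_univ_of_forall fun x => ?_
      obtain ⟨i, hi, hx⟩ := mem_iUnion₂.1 (ht (mem_univ x))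
      exact mem_iUnion.2 ⟨t.equivFin ⟨i, hi⟩, by simpa using hx⟩)
  obtain ⟨s, hs⟩ := isCompact_univ.elim_finite_subcover V h1 h2.ge
  refine ⟨s, inferInstance, fun j => V j, fun j => h1 j, ?_, fun j => ?_, fun x => ?_⟩
  · refine eq_univ_of_forall fun x => ?_
    obtain ⟨j, hj, hx⟩ := mem_iUnion₂.1 (hs (mem_univ x))
    exact mem_iUnion.2 ⟨⟨j, hj⟩, hx⟩
  · obtain ⟨i, hi⟩ := h3 j
    exact ⟨_, hi⟩
  · refine le_trans ?_ (h4 x).2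
    exact ncard_le_ncard_of_injOn Subtype.val (fun j hj => hj) Subtype.val_injective.injOn (h4 x).1

/-- Maps from a space of covering order at most `k` are approximated by maps through a polyhedron
whose simplices have at most `k` vertices. -/
theorem CovOrderLE.exists_polyhedral_approx {X F : Type*} [TopologicalSpace X] [CompactSpace X]
    [T2Space X] [NormedAddCommGroup F] [NormedSpace ℝ F] {k : ℕ} (h : CovOrderLE X k)
    (g : C(X, F)) {ε : ℝ} (hε : 0 < ε) :
    ∃ (ι : Type) (_ : Fintype ι) (φ : ι → C(X, ℝ)) (a : ι → F),
      (∀ x, ∑ i, φ i x = 1) ∧ (∀ x, {i | φ i x ≠ 0}.ncard ≤ k) ∧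
      ∀ x, dist (∑ i, φ i x • a i) (g x) < ε := by
  obtain ⟨κ, hκ, V, h1, h2, h3, h4⟩ := h.exists_finite_refinement (fun p : X => g ⁻¹' ball (g p) ε)
    (fun p => isOpen_ball.preimage g.continuous)
    (eq_univ_of_forall fun x => mem_iUnion.2 ⟨x, mem_ball_self hε⟩)
  choose c hcV using h3
  obtain ⟨φ, hφ⟩ := PartitionOfUnity.exists_isSubordinate isClosed_univ V h1 h2.ge
  have hmem : ∀ x i, φ i x ≠ 0 → x ∈ V i := fun x i hi => hφ i (subset_tsupport _ hi)
  refine ⟨κ, hκ, fun i => φ i, fun i => g (c i), fun x => ?_, fun x => ?_, fun x => ?_⟩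
  · rw [← finsum_eq_sum_of_fintype]
    exact φ.sum_eq_one (mem_univ x)
  · exact (ncard_le_ncard (fun i hi => hmem x i hi)).trans (h4 x)
  · have := φ.finsum_smul_mem_convex (g := fun i _ => g (c i)) (t := ball (g x) ε) (mem_univ x)
      (fun i hi => by
        have := hcV i (hmem x i hi)
        rw [mem_ball, dist_comm]
        exact this) (convex_ball _ _)
    rwa [finsum_eq_sum_of_fintype] at this

/-- General position: finitely many families of points depending smoothly on `P`, whose
parametrized simplices have too small a dimension to fill the space, miss arbitrarily small
vectors. -/
theorem exists_small_notMem_affine_combinations {ι P E : Type*} [Fintype ι]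
    [NormedAddCommGroup P] [NormedSpace ℝ P] [FiniteDimensional ℝ P]
    [NormedAddCommGroup E] [NormedSpace ℝ E] [FiniteDimensional ℝ E] {k : ℕ}
    (hk : k + finrank ℝ P ≤ finrank ℝ E) (a : ι → P → E) (ha : ∀ i, ContDiff ℝ 1 (a i))
    {ε : ℝ} (hε : 0 < ε) :
    ∃ v : E, ‖v‖ < ε ∧ ∀ w : ι → ℝ, ∑ i, w i = 1 → {i | w i ≠ 0}.ncard ≤ k →
      ∀ p, ∑ i, w i • a i p + v ≠ 0 := by
  classical
  let T := {r : Finset ι × ι // r.1.card ≤ k ∧ r.2 ∈ r.1}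
  let G (S : Finset ι) (s : ι) (q : (↥(S.erase s) → ℝ) × P) : E :=
    a s q.2 + ∑ i : ↥(S.erase s), q.1 i • (a i q.2 - a s q.2)
  have hlt : ∀ r : T, dimH (range (G r.1.1 r.1.2)) < finrank ℝ E := by
    rintro ⟨⟨S, s⟩, hS, hs⟩
    have hG : ContDiff ℝ 1 (G S s) := by fun_prop
    refine hG.dimH_range_le.trans_lt (Nat.cast_lt.2 ?_)
    dsimp only at hS hs
    have := Finset.card_pos.2 ⟨s, hs⟩
    rw [finrank_prod, finrank_fintype_fun_eq_card, Fintype.card_coe, Finset.card_erase_of_mem hs]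
    omega
  have hkey : ∀ w : ι → ℝ, ∑ i, w i = 1 → {i | w i ≠ 0}.ncard ≤ k →
      ∃ r : T, ∀ p, ∑ i, w i • a i p ∈ range (G r.1.1 r.1.2) := by
    intro w hw hwk
    set S : Finset ι := Finset.univ.filter fun i => w i ≠ 0 with hS
    have hSk : S.card ≤ k := by
      rw [← ncard_coe_finset]
      simpa [hS] using hwk
    have hsum : ∀ b : ι → E, ∑ i, w i • b i = ∑ i ∈ S, w i • b i := fun b => by
      refine (Finset.sum_subset (Finset.subset_univ _) fun i _ hi => ?_).symm
      have : w i = 0 := by simpa [hS] using hi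
      rw [this, zero_smul]
    have hone : ∑ i ∈ S, w i = 1 := by
      rw [← hw]
      exact Finset.sum_subset (Finset.subset_univ _) fun i _ hi => by simpa [hS] using hi
    obtain ⟨s, hs⟩ : S.Nonempty := by
      by_contra hne
      rw [Finset.not_nonempty_iff_eq_empty] at hne
      simp [hne] at hone
    refine ⟨⟨⟨S, s⟩, hSk, hs⟩, fun p => ⟨(fun i => w i, p), ?_⟩⟩
    have h1 : ∑ i ∈ S.erase s, w i = 1 - w s := by
      rw [← hone, ← Finset.add_sum_erase _ _ hs]
      ring
    rw [hsum, ← Finset.add_sum_erase _ _ hs]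
    simp only [G]
    rw [Finset.sum_coe_sort (S.erase s) (fun i => w i • (a i p - a s p))]
    simp only [smul_sub, Finset.sum_sub_distrib, ← Finset.sum_smul, h1, sub_smul, one_smul]
    abel
  rcases isEmpty_or_nonempty T with he | hne
  · refine ⟨0, by simpa using hε, fun w hw hwk => ?_⟩
    obtain ⟨r, -⟩ := hkey w hw hwk
    exact he.elim r
  · have hbad : dimH (⋃ r : T, range (G r.1.1 r.1.2)) < finrank ℝ E := by
      rw [dimH_iUnion]
      obtain ⟨r, hr⟩ := exists_eq_ciSup_of_finite (f := fun r : T => dimH (range (G r.1.1 r.1.2)))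
      rw [← hr]
      exact hlt r
    obtain ⟨v, hv, hvε⟩ := (dense_compl_of_dimH_lt_finrank hbad).exists_dist_lt 0 hε
    refine ⟨-v, by simpa using hvε, fun w hw hwk p h0 => hv ?_⟩
    obtain ⟨r, hr⟩ := hkey w hw hwk
    rw [← sub_eq_add_neg, sub_eq_zero] at h0
    exact mem_iUnion.2 ⟨r, h0 ▸ hr p⟩

/-- Nowhere vanishing maps into `ℝᵏ` are dense: the origin is an unstable value of every map. -/
def DenseNonvanishing (k : ℕ) (X : Type*) [TopologicalSpace X] : Prop :=
  Dense {h : C(X, Fin k → ℝ) | ∀ x, h x ≠ 0}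

theorem CovOrderLE.denseNonvanishing {X : Type*} [TopologicalSpace X] [CompactSpace X]
    [T2Space X] {k : ℕ} (h : CovOrderLE X k) : DenseNonvanishing k X := by
  refine Metric.dense_iff.2 fun g ε hε => ?_
  obtain ⟨ι, _, φ, a, h1, h2, h3⟩ := h.exists_polyhedral_approx g (half_pos hε)
  obtain ⟨v, hv, hne⟩ := exists_small_notMem_affine_combinations (P := Fin 0 → ℝ) (k := k)
    (E := Fin k → ℝ) (by simp) (fun i _ => a i) (fun i => contDiff_const) (half_pos hε)
  refine ⟨⟨fun x => ∑ i, φ i x • a i + v, by fun_prop⟩, ?_, fun x => hne _ (h1 x) (h2 x) 0⟩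
  rw [mem_ball, ContinuousMap.dist_lt_iff hε]
  intro x
  calc dist (∑ i, φ i x • a i + v) (g x)
      ≤ dist (∑ i, φ i x • a i + v) (∑ i, φ i x • a i) + dist (∑ i, φ i x • a i) (g x) :=
        dist_triangle _ _ _
    _ < ε / 2 + ε / 2 := add_lt_add (by simpa using hv) (h3 x)
    _ = ε := add_halves ε

/-- Two maps of a space of covering order at most `k` into `ℝᵏ⁺¹` can be perturbed so that the
straight-line homotopy between them does not vanish. -/
theorem CovOrderLE.exists_nonvanishing_segment {X : Type*} [TopologicalSpace X] [CompactSpace X]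
    [T2Space X] {k : ℕ} (h : CovOrderLE X k) (g₀ g₁ : C(X, Fin (k + 1) → ℝ)) {ε : ℝ}
    (hε : 0 < ε) :
    ∃ p₀ p₁ : C(X, Fin (k + 1) → ℝ), (∀ x, dist (p₀ x) (g₀ x) < ε) ∧
      (∀ x, dist (p₁ x) (g₁ x) < ε) ∧ ∀ x, ∀ t : ℝ, (1 - t) • p₀ x + t • p₁ x ≠ 0 := by
  obtain ⟨ι, _, φ, a, h1, h2, h3⟩ := h.exists_polyhedral_approx (g₀.prodMk g₁) (half_pos hε)
  obtain ⟨v, hv, hne⟩ := exists_small_notMem_affine_combinations (P := ℝ) (k := k)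
    (E := Fin (k + 1) → ℝ) (by simp) (fun i t => (1 - t) • (a i).1 + t • (a i).2)
    (fun i => by fun_prop) (half_pos hε)
  have hclose : ∀ (b c : Fin (k + 1) → ℝ), dist b c < ε / 2 → dist (b + v) c < ε := by
    intro b c hbc
    calc dist (b + v) c ≤ dist (b + v) b + dist b c := dist_triangle _ _ _
      _ < ε / 2 + ε / 2 := add_lt_add (by simpa using hv) hbc
      _ = ε := add_halves ε
  refine ⟨⟨fun x => ∑ i, φ i x • (a i).1 + v, by fun_prop⟩,
    ⟨fun x => ∑ i, φ i x • (a i).2 + v, by fun_prop⟩, fun x => hclose _ _ ?_,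
    fun x => hclose _ _ ?_, fun x t => ?_⟩
  · have := h3 x
    rw [Prod.dist_eq, max_lt_iff] at this
    simpa [Prod.fst_sum] using this.1
  · have := h3 x
    rw [Prod.dist_eq, max_lt_iff] at this
    simpa [Prod.snd_sum] using this.2
  · convert hne _ (h1 x) (h2 x) t using 1
    simp only [ContinuousMap.coe_mk, smul_add, Finset.smul_sum, Finset.sum_add_distrib]
    simp only [smul_comm _ t, smul_comm _ (1 - t)]
    module

/-- If nowhere vanishing maps into `ℝᵏ` are dense, then any `k + 1` members of a finite open cover
can be shrunk so that they have no common point. -/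
theorem DenseNonvanishing.exists_shrinking {X : Type*} [TopologicalSpace X] [CompactSpace X]
    [T2Space X] {k : ℕ} (h : DenseNonvanishing k X) {ι : Type*} [Fintype ι] (U : ι → Set X)
    (hU : ∀ i, IsOpen (U i)) (hc : (⋃ i, U i) = univ) (e : Fin (k + 1) → ι)
    (he : Function.Injective e) :
    ∃ V : ι → Set X, (∀ i, IsOpen (V i)) ∧ (⋃ i, V i) = univ ∧ (∀ i, V i ⊆ U i) ∧
      ∀ x, ∃ j, x ∉ V (e j) := by
  classical
  obtain ⟨φ, hφ⟩ := PartitionOfUnity.exists_isSubordinate isClosed_univ U hU hc.ge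
  have hmem : ∀ x i, φ i x ≠ 0 → x ∈ U i := fun x i hi => hφ i (subset_tsupport _ hi)
  have hk : (0 : ℝ) < 1 / (2 * (k + 1)) := by positivity
  obtain ⟨g, hg0, hg⟩ := Metric.dense_iff.1 h
    ⟨fun x j => φ (e j.succ) x - φ (e 0) x, by fun_prop⟩ _ hk
  rw [mem_ball, ContinuousMap.dist_lt_iff hk] at hg0
  let G (j : Fin (k + 1)) (x : X) : ℝ := Fin.cons (α := fun _ => ℝ) 0 (g x) j
  have hGc : ∀ j, Continuous (G j) := by
    refine Fin.cases ?_ fun j => ?_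
    · simpa [G] using continuous_const
    · simp only [G, Fin.cons_succ]
      fun_prop
  have hG : ∀ j x, |G j x - (φ (e j) x - φ (e 0) x)| < 1 / (2 * (k + 1)) := by
    refine Fin.cases (fun x => ?_) fun j x => ?_
    · simpa [G] using hk
    · have := (dist_pi_lt_iff hk).1 (hg0 x) j
      rw [Real.dist_eq] at this
      exact this
  have hGne : ∀ x, ∃ i j, G i x < G j x := by
    intro x
    obtain ⟨j, hj⟩ := Function.ne_iff.1 (hg x)
    rcases lt_or_gt_of_ne hj with hj | hj
    · exact ⟨j.succ, 0, by simpa [G] using hj⟩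
    · exact ⟨0, j.succ, by simpa [G] using hj⟩
  refine ⟨fun i => U i ∩ {x | ∀ j, e j = i → ∃ l, G l x < G j x}, fun i => ?_, ?_,
    fun i => inter_subset_left, fun x => ?_⟩
  · refine (hU i).inter ?_
    simp only [ofPred_forall, ofPred_exists]
    exact isOpen_iInter_of_finite fun j => isOpen_iInter_of_finite fun _ =>
      isOpen_iUnion fun l => isOpen_lt (hGc l) (hGc j)
  · refine eq_univ_of_forall fun x => mem_iUnion.2 ?_
    by_cases hx : ∃ i, i ∉ range e ∧ x ∈ U i
    · obtain ⟨i, hi, hxi⟩ := hx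
      exact ⟨i, hxi, fun j hj => (hi ⟨j, hj⟩).elim⟩
    push Not at hx
    have hsum : ∑ j, φ (e j) x = 1 := by
      rw [← φ.sum_eq_one (mem_univ x), finsum_eq_sum_of_fintype,
        ← Finset.sum_image (f := fun i => φ i x) (s := Finset.univ) (g := e) he.injOn]
      refine Finset.sum_subset (Finset.subset_univ _) fun i _ hi => ?_
      by_contra hne
      exact hx i (by simpa using hi) (hmem x i hne)
    obtain ⟨j₀, -, hj₀⟩ : ∃ j ∈ Finset.univ, 1 / (k + 1 : ℝ) ≤ φ (e j) x := by
      refine Finset.exists_le_of_sum_le Finset.univ_nonempty ?_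
      rw [hsum]
      simp
      field_simp
      rfl
    obtain ⟨j, hj⟩ := Finite.exists_max fun j => G j x
    obtain ⟨a, b, hab⟩ := hGne x
    refine ⟨e j, hmem x _ (ne_of_gt ?_), fun l hl => ⟨a, ?_⟩⟩
    · have h1 := abs_lt.1 (hG j x)
      have h2 := abs_lt.1 (hG j₀ x)
      have h3 := hj j₀
      have h4 : 1 / (k + 1 : ℝ) = 1 / (2 * (k + 1)) + 1 / (2 * (k + 1)) := by
        field_simp
        norm_num
      linarith [h1.2, h2.1]
    · rw [he hl]
      exact hab.trans_le (hj b)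
  · obtain ⟨j, hj⟩ := Finite.exists_min fun j => G j x
    refine ⟨j, fun hx => ?_⟩
    obtain ⟨l, hl⟩ := hx.2 j rfl
    exact (hj l).not_gt hl

theorem DenseNonvanishing.covOrderLE {X : Type*} [TopologicalSpace X] [CompactSpace X]
    [T2Space X] {k : ℕ} (h : DenseNonvanishing k X) : CovOrderLE X k := by
  classical
  intro ι U hU hc
  obtain ⟨t, ht⟩ := isCompact_univ.elim_finite_subcover U hU hc.ge
  suffices H : ∀ 𝒮 : Finset (Finset t), (∀ S ∈ 𝒮, S.card = k + 1) →
      ∃ V : t → Set X, (∀ i, IsOpen (V i)) ∧ (⋃ i, V i) = univ ∧ (∀ i, V i ⊆ U i) ∧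
        ∀ S ∈ 𝒮, ∀ x, ∃ i ∈ S, x ∉ V i by
    obtain ⟨V, h1, h2, h3, h4⟩ := H (Finset.univ.filter fun S => S.card = k + 1)
      fun S hS => (Finset.mem_filter.1 hS).2
    refine ⟨t, V, h1, h2, fun i => ⟨i, h3 i⟩, fun x => ⟨toFinite _, ?_⟩⟩
    by_contra! hlt
    rw [ncard_eq_toFinset_card'] at hlt
    obtain ⟨S, hS, hSk⟩ := Finset.exists_subset_card_eq (Nat.succ_le_of_lt hlt)
    obtain ⟨i, hi, hx⟩ := h4 S (Finset.mem_filter.2 ⟨Finset.mem_univ _, hSk⟩) x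
    exact hx (by simpa using hS hi)
  intro 𝒮
  induction 𝒮 using Finset.induction_on with
  | empty =>
    refine fun _ => ⟨fun i => U i, fun i => hU i, eq_univ_of_forall fun x => ?_,
      fun i => Subset.rfl, by simp⟩
    obtain ⟨i, hi, hx⟩ := mem_iUnion₂.1 (ht (mem_univ x))
    exact mem_iUnion.2 ⟨⟨i, hi⟩, hx⟩
  | insert S 𝒮 _ ih =>
    intro hcard
    obtain ⟨V, h1, h2, h3, h4⟩ := ih fun S' hS' => hcard S' (Finset.mem_insert_of_mem hS')
    have hS := hcard S (Finset.mem_insert_self _ _)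
    let e := S.equivFinOfCardEq hS
    obtain ⟨W, k1, k2, k3, k4⟩ := h.exists_shrinking V h1 h2 (fun j => (e.symm j : t))
      (Subtype.val_injective.comp e.symm.injective)
    refine ⟨W, k1, k2, fun i => (k3 i).trans (h3 i), fun S' hS' x => ?_⟩
    rcases Finset.mem_insert.1 hS' with rfl | hS'
    · obtain ⟨j, hj⟩ := k4 x
      exact ⟨_, (e.symm j).2, hj⟩
    · obtain ⟨i, hi, hx⟩ := h4 S' hS' x
      exact ⟨i, hi, fun hxW => hx (k3 i hxW)⟩

/-- In a space where nowhere vanishing maps into `ℝᵏ⁺¹` are dense, disjoint closed sets are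
separated by the zero set of a real function on which nowhere vanishing maps into `ℝᵏ` are
dense. -/
theorem DenseNonvanishing.exists_separating {X : Type*} [MetricSpace X] [CompactSpace X] {k : ℕ}
    (h : DenseNonvanishing (k + 1) X) {C D : Set X} (hC : IsClosed C) (hD : IsClosed D)
    (hCD : Disjoint C D) :
    ∃ u : C(X, ℝ), (∀ x ∈ C, u x < 0) ∧ (∀ x ∈ D, 0 < u x) ∧
      DenseNonvanishing k (u ⁻¹' {0} : Set X) := by
  let good (r : ℕ × ℕ) : Set C(X, ℝ) :=
    ⋃ g ∈ ball (TopologicalSpace.denseSeq C(X, Fin k → ℝ) r.1) (1 / (r.2 + 1 : ℝ)),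
      {u | range (u.prodMk g) ⊆ {0}ᶜ}
  have hopen : ∀ r, IsOpen (good r) := fun r => isOpen_biUnion fun g _ =>
    (ContinuousMap.isOpen_setOfPred_range_subset isOpen_compl_singleton).preimage
      (f := fun u : C(X, ℝ) => u.prodMk g)
      (ContinuousMap.continuous_of_continuous_uncurry _ (by
        simp only [Function.uncurry_def, ContinuousMap.prod_eval]
        fun_prop))
  have hdense : ∀ r, Dense (good r) := by
    intro r
    refine Metric.dense_iff.2 fun u ε hε => ?_
    have hδ : 0 < min ε (1 / (r.2 + 1 : ℝ)) := lt_min hε (by positivity)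
    set g := TopologicalSpace.denseSeq C(X, Fin k → ℝ) r.1 with hg
    obtain ⟨F, hF, hF0⟩ := Metric.dense_iff.1 h
      ⟨fun x => Fin.cons (u x) (g x), by fun_prop⟩ _ hδ
    rw [mem_ball, ContinuousMap.dist_lt_iff hδ] at hF
    have hF' := fun x => (dist_pi_lt_iff hδ).1 (hF x)
    refine ⟨⟨fun x => F x 0, by fun_prop⟩, ?_, mem_iUnion₂.2
      ⟨⟨fun x j => F x j.succ, by fun_prop⟩, ?_, ?_⟩⟩
    · rw [mem_ball, ContinuousMap.dist_lt_iff hε]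
      exact fun x => by simpa using (hF' x 0).trans_le (min_le_left _ _)
    · rw [mem_ball, ContinuousMap.dist_lt_iff (by positivity)]
      exact fun x => (dist_pi_lt_iff (by positivity)).2 fun j =>
        by simpa using (hF' x j.succ).trans_le (min_le_right _ _)
    · rintro _ ⟨x, rfl⟩ h0
      refine hF0 x (funext fun j => ?_)
      have h0 := Prod.ext_iff.1 (mem_singleton_iff.1 h0)
      refine Fin.cases ?_ (fun j => ?_) j
      · simpa using h0.1
      · simpa using congrFun h0.2 j
  obtain ⟨w, hwC, hwD, -⟩ := exists_continuous_zero_one_of_isClosed hC hD hCD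
  obtain ⟨u, ⟨huC, huD⟩, hu⟩ := (dense_iInter_of_isOpen hopen hdense).inter_open_nonempty
    ({u | MapsTo u C (Iio 0)} ∩ {u | MapsTo u D (Ioi 0)})
    ((ContinuousMap.isOpen_setOfPred_mapsTo hC.isCompact isOpen_Iio).inter
      (ContinuousMap.isOpen_setOfPred_mapsTo hD.isCompact isOpen_Ioi))
    ⟨⟨fun x => w x - 1 / 2, by fun_prop⟩, fun x hx => by simp [hwC hx],
      fun x hx => by simp [hwD hx]; norm_num⟩
  have hZ : IsClosed (u ⁻¹' {0}) := isClosed_singleton.preimage u.continuous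
  have := isCompact_iff_compactSpace.1 hZ.isCompact
  refine ⟨u, huC, huD, Metric.dense_iff.2 fun g ε hε => ?_⟩
  obtain ⟨g', rfl⟩ := ContinuousMap.exists_restrict_eq hZ g
  obtain ⟨i, hi⟩ := (TopologicalSpace.denseRange_denseSeq C(X, Fin k → ℝ)).exists_dist_lt g'
    (half_pos hε)
  obtain ⟨l, hl⟩ := exists_nat_one_div_lt (half_pos hε)
  obtain ⟨f, hf, hfu⟩ := mem_iUnion₂.1 (mem_iInter.1 hu (i, l))
  refine ⟨f.restrict _, ?_, fun x hx => hfu ⟨x, rfl⟩ (Prod.ext x.2 hx)⟩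
  rw [mem_ball, ContinuousMap.dist_lt_iff hε]
  intro x
  refine (ContinuousMap.dist_apply_le_dist (f := f) (g := g') x.1).trans_lt ?_
  rw [dist_comm] at hi
  have := dist_triangle f (TopologicalSpace.denseSeq C(X, Fin k → ℝ) i) g'
  rw [mem_ball] at hf
  linarith

/-- A section of an open subset `G` of `X × E` over `S` can be modified so as to take prescribed
values on a closed set `D`, if the segments between the old and the new values lie in `G`. -/
theorem exists_section_eqOn {X E : Type*} [TopologicalSpace X] [CompactSpace X] [T2Space X]
    [NormedAddCommGroup E] [NormedSpace ℝ E] {G : Set (X × E)} (hG : IsOpen G) {S D : Set X}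
    (hD : IsClosed D) (h q : C(X, E)) (hS : ∀ x ∈ S, (x, h x) ∈ G)
    (hseg : ∀ x ∈ D, ∀ t ∈ Icc (0 : ℝ) 1, (x, (1 - t) • q x + t • h x) ∈ G) :
    ∃ h' : C(X, E), (∀ x ∈ S, (x, h' x) ∈ G) ∧ EqOn h' q D := by
  let R : Set X := {x | ∀ t ∈ Icc (0 : ℝ) 1, (x, (1 - t) • q x + t • h x) ∈ G}
  have hR : IsOpen R := by
    refine isOpen_iff_mem_nhds.2 fun x hx =>
      isCompact_Icc.eventually_forall_of_forall_eventually fun t ht => ?_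
    have hc : Continuous fun z : X × ℝ => (z.1, (1 - z.2) • q z.1 + z.2 • h z.1) := by fun_prop
    exact hc.continuousAt.eventually (hG.mem_nhds (hx t ht))
  obtain ⟨τ, hτD, hτR, hτ⟩ := exists_continuous_zero_one_of_isClosed hD hR.isClosed_compl
    (disjoint_compl_right_iff_subset.2 hseg)
  refine ⟨⟨fun x => (1 - τ x) • q x + τ x • h x, by fun_prop⟩, fun x hx => ?_, fun x hx => ?_⟩
  · by_cases hxR : x ∈ R
    · exact hxR _ (hτ x)
    · simpa [hτR hxR] using hS x hx
  · simp [hτD hx]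

/-- Gluing approximations of `g` without zeros along a set of small dimension. -/
theorem exists_nonvanishing_approx_union {X : Type*} [MetricSpace X] [CompactSpace X] {k : ℕ}
    (g : C(X, Fin (k + 1) → ℝ)) {ε : ℝ} {S₁ S₂ B : Set X} (hS₁ : IsClosed S₁)
    (hS₂ : IsClosed S₂) (hB : IsClosed B) (hSB : S₁ ∩ S₂ ⊆ B) (hBk : CovOrderLE B k)
    (h₁ : ∃ h : C(X, Fin (k + 1) → ℝ), ∀ x ∈ S₁, h x ≠ 0 ∧ dist (h x) (g x) < ε)
    (h₂ : ∃ h : C(X, Fin (k + 1) → ℝ), ∀ x ∈ S₂, h x ≠ 0 ∧ dist (h x) (g x) < ε) :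
    ∃ h : C(X, Fin (k + 1) → ℝ), ∀ x ∈ S₁ ∪ S₂, h x ≠ 0 ∧ dist (h x) (g x) < ε := by
  classical
  obtain ⟨h₁, hh₁⟩ := h₁
  obtain ⟨h₂, hh₂⟩ := h₂
  let E := Fin (k + 1) → ℝ
  let G : Set (X × E) := {z | z.2 ≠ 0 ∧ dist z.2 (g z.1) < ε}
  have hG : IsOpen G := (isOpen_ne_fun continuous_snd continuous_const).inter
    (isOpen_lt (continuous_snd.dist (g.continuous.comp continuous_fst)) continuous_const)
  let D := S₁ ∩ S₂
  have hD : IsClosed D := hS₁.inter hS₂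
  have hδ : ∀ h : C(X, E), (∀ x ∈ D, (x, h x) ∈ G) →
      ∃ δ > 0, ∀ x ∈ D, ∀ e, dist e (h x) < δ → (x, e) ∈ G := by
    intro h hh
    obtain ⟨δ, hδ, hδG⟩ := (hD.isCompact.image
      (f := fun x => (x, h x)) (by fun_prop)).exists_thickening_subset_open hG
      (image_subset_iff.2 hh)
    refine ⟨δ, hδ, fun x hx e he => hδG (mem_thickening_iff.2 ⟨_, mem_image_of_mem _ hx, ?_⟩)⟩
    simpa [Prod.dist_eq, hδ] using he
  obtain ⟨δ₁, hδ₁, hG₁⟩ := hδ h₁ fun x hx => hh₁ x hx.1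
  obtain ⟨δ₂, hδ₂, hG₂⟩ := hδ h₂ fun x hx => hh₂ x hx.2
  have := isCompact_iff_compactSpace.1 hB.isCompact
  obtain ⟨p₁, p₂, hp₁, hp₂, hp⟩ := hBk.exists_nonvanishing_segment (h₁.restrict B) (h₂.restrict B)
    (lt_min hδ₁ hδ₂)
  obtain ⟨q₁, rfl⟩ := ContinuousMap.exists_restrict_eq hB p₁
  obtain ⟨q₂, rfl⟩ := ContinuousMap.exists_restrict_eq hB p₂
  have hq₁ : ∀ x ∈ D, dist (q₁ x) (h₁ x) < δ₁ := fun x hx =>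
    (hp₁ ⟨x, hSB hx⟩).trans_le (min_le_left _ _)
  have hq₂ : ∀ x ∈ D, dist (q₂ x) (h₂ x) < δ₂ := fun x hx =>
    (hp₂ ⟨x, hSB hx⟩).trans_le (min_le_right _ _)
  have hball : ∀ {a b c : E} {r t : ℝ}, t ∈ Icc (0 : ℝ) 1 → dist a c < r → dist b c < r →
      dist ((1 - t) • a + t • b) c < r := fun {a b c r t} ht ha hb =>
    convex_ball c r ha hb (sub_nonneg.2 ht.2) ht.1 (by ring)
  obtain ⟨a, haG, haD⟩ := exists_section_eqOn hG hD h₂ q₂ hh₂ fun x hx t ht =>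
    hG₂ x hx _ (hball ht (hq₂ x hx) (by simpa using hδ₂))
  obtain ⟨b, hbG, hbD⟩ := exists_section_eqOn hG hD a q₁ haG fun x hx t ht => by
    rw [haD hx]
    exact ⟨hp ⟨x, hSB hx⟩ t, hball ht (hG₁ x hx _ (hq₁ x hx)).2 (hG₂ x hx _ (hq₂ x hx)).2⟩
  obtain ⟨c, hcG, hcD⟩ := exists_section_eqOn hG hD b h₁ hbG fun x hx t ht => by
    rw [hbD hx]
    exact hG₁ x hx _ (hball ht (by simpa using hδ₁) (hq₁ x hx))
  let F : X → E := fun x => if x ∈ S₁ then h₁ x else c x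
  have hF₁ : EqOn F h₁ S₁ := fun x hx => if_pos hx
  have hF₂ : EqOn F c S₂ := fun x hx => by
    by_cases hx₁ : x ∈ S₁
    · rw [hF₁ hx₁, hcD ⟨hx₁, hx⟩]
    · exact if_neg hx₁
  have hF : ContinuousOn F (S₁ ∪ S₂) :=
    (h₁.continuous.continuousOn.congr hF₁).union_of_isClosed
      (c.continuous.continuousOn.congr hF₂) hS₁ hS₂
  obtain ⟨h, hh⟩ := ContinuousMap.exists_restrict_eq (hS₁.union hS₂) ⟨_, hF.domRestrict⟩
  have hhF : ∀ x ∈ S₁ ∪ S₂, h x = F x := fun x hx => DFunLike.congr_fun hh ⟨x, hx⟩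
  refine ⟨h, fun x hx => ?_⟩
  rw [hhF x hx]
  rcases hx with hx | hx
  · rw [hF₁ hx]
    exact hh₁ x hx
  · rw [hF₂ hx]
    exact hcG x hx

/-- The Hurewicz mapping theorem, in terms of the order of refinements; order `k` of refinements
of covers of `Y` is dimension at most `k - 1`. -/
theorem covOrderLE_of_fibers {X Y : Type*} [MetricSpace X] [CompactSpace X] [MetricSpace Y]
    [CompactSpace Y] (f : C(X, Y)) {n k : ℕ} (hfib : ∀ y : Y, CovOrderLE (f ⁻¹' {y}) (n + 1))
    (hY : CovOrderLE Y k) : CovOrderLE X (n + k) := by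
  induction k generalizing X Y with
  | zero =>
    have := hY.isEmpty
    have : IsEmpty X := Function.isEmpty f
    intro ι U _ _
    exact ⟨Empty, fun _ => ∅, by simp, Subsingleton.elim _ _, by simp, fun x => isEmptyElim x⟩
  | succ k ih =>
    refine DenseNonvanishing.covOrderLE (k := n + k + 1) (Metric.dense_iff.2 fun g ε hε => ?_)
    let good (S : Set X) : Prop :=
      ∃ h : C(X, Fin (n + k + 1) → ℝ), ∀ x ∈ S, h x ≠ 0 ∧ dist (h x) (g x) < ε
    have hfiber : ∀ y, ∀ᶠ s in (𝓝 y).smallSets, good (f ⁻¹' s) := by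
      intro y
      have hF : IsClosed (f ⁻¹' {y}) := isClosed_singleton.preimage f.continuous
      have := isCompact_iff_compactSpace.1 hF.isCompact
      obtain ⟨p, hp, hp0⟩ := Metric.dense_iff.1
        ((hfib y).mono (by omega : n + 1 ≤ n + k + 1)).denseNonvanishing
        (g.restrict (f ⁻¹' {y})) ε hε
      rw [mem_ball, ContinuousMap.dist_lt_iff hε] at hp
      obtain ⟨h, rfl⟩ := ContinuousMap.exists_restrict_eq hF p
      have hev := f.continuous.isClosedMap.eventually_nhds_fiber
        (p := fun x => h x ≠ 0 ∧ dist (h x) (g x) < ε) y fun x hx =>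
        (h.continuous.continuousAt.eventually_ne (hp0 ⟨x, hx⟩)).and
          ((by fun_prop : Continuous fun x => dist (h x) (g x)).continuousAt.eventually_lt
            continuousAt_const (hp ⟨x, hx⟩))
      exact hev.smallSets.mono fun s hs => ⟨h, fun x hx => hs (f x) hx x rfl⟩
    obtain ⟨O, hO, -, h, hh⟩ : ∃ O : Set Y, closure univ ⊆ O ∧ IsOpen O ∧ good (f ⁻¹' O) := by
      refine isCompact_univ.induction_on
        (p := fun s => ∃ O : Set Y, closure s ⊆ O ∧ IsOpen O ∧ good (f ⁻¹' O))
        ⟨∅, by simp, isOpen_empty, 0, by simp⟩ ?_ ?_ fun y _ => ?_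
      · rintro s t hst ⟨O, h1, h2⟩
        exact ⟨O, (closure_mono hst).trans h1, h2⟩
      · rintro s t ⟨O₁, hs, hO₁, hg₁⟩ ⟨O₂, ht, hO₂, hg₂⟩
        obtain ⟨W, hW, htW, hWO⟩ := normal_exists_closure_subset isClosed_closure hO₂ ht
        obtain ⟨u, hu₁, hu₂, hu⟩ := hY.denseNonvanishing.exists_separating isClosed_closure
          hO₁.isClosed_compl (disjoint_compl_right_iff_subset.2 hs)
        refine ⟨{y | u y < 0} ∪ W, ?_, (isOpen_lt (by fun_prop) (by fun_prop)).union hW, ?_⟩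
        · rw [closure_union]
          exact union_subset_union hu₁ htW
        have hZ : IsClosed (u ⁻¹' {0}) := isClosed_singleton.preimage u.continuous
        have := isCompact_iff_compactSpace.1 hZ.isCompact
        have := isCompact_iff_compactSpace.1 (hZ.preimage f.continuous).isCompact
        have hB : CovOrderLE (f ⁻¹' (u ⁻¹' {0})) (n + k) := by
          refine ih ⟨(u ⁻¹' {0}).restrictPreimage f, f.continuous.restrictPreimage⟩
            (fun y => (hfib y).of_homeomorph ?_) hu.covOrderLE
          exact
            { toFun := fun x => ⟨x.1.1, congrArg Subtype.val x.2⟩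
              invFun := fun x => ⟨⟨x.1, by
                have : f x.1 = y := x.2
                rw [mem_preimage, this]
                exact y.2⟩, Subtype.ext x.2⟩
              left_inv := fun x => rfl
              right_inv := fun x => rfl
              continuous_toFun := by fun_prop
              continuous_invFun := by fun_prop }
        obtain ⟨h₁, hh₁⟩ := hg₁
        obtain ⟨h₂, hh₂⟩ := hg₂
        obtain ⟨h, hh⟩ := exists_nonvanishing_approx_union g (ε := ε)
          (S₁ := f ⁻¹' {y | u y ≤ 0}) (S₂ := f ⁻¹' (closure W ∩ {y | 0 ≤ u y}))
          ((isClosed_le (by fun_prop) (by fun_prop)).preimage f.continuous)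
          ((isClosed_closure.inter (isClosed_le (by fun_prop) (by fun_prop))).preimage f.continuous)
          (hZ.preimage f.continuous) (fun x hx => le_antisymm hx.1 hx.2.2) hB
          ⟨h₁, fun x hx => hh₁ x (by
            by_contra hxO
            exact (hu₂ (f x) hxO).not_ge hx)⟩
          ⟨h₂, fun x hx => hh₂ x (hWO hx.1)⟩
        refine ⟨h, fun x hx => hh x ?_⟩
        rcases le_total (u (f x)) 0 with hx0 | hx0
        · exact Or.inl hx0
        · rcases hx with hx | hx
          · exact Or.inl (show u (f x) ≤ 0 from le_of_lt hx)
          · exact Or.inr ⟨subset_closure hx, hx0⟩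
      · obtain ⟨s, hs, hsg⟩ := Filter.eventually_smallSets.1 (hfiber y)
        obtain ⟨t, ht, htc, hts⟩ := exists_mem_nhds_isClosed_subset (interior_mem_nhds.2 hs)
        exact ⟨t, by simpa using ht, interior s, by rwa [htc.closure_eq], isOpen_interior,
          hsg _ interior_subset⟩
    have hh' : ∀ x, h x ≠ 0 ∧ dist (h x) (g x) < ε := fun x => hh x (hO (subset_closure trivial))
    exact ⟨h, (ContinuousMap.dist_lt_iff hε).2 fun x => (hh' x).2, fun x => (hh' x).1⟩

theorem hurewicz_mapping_theorem {X Y : Type*} [MetricSpace X] [CompactSpace X]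
    [MetricSpace Y] [CompactSpace Y] (f : C(X, Y)) (n m : ℕ)
    (hfib : ∀ y : Y, CovDimLE (⇑f ⁻¹' {y}) n) (hY : CovDimLE Y m) :
    CovDimLE X (n + m) :=
  covOrderLE_of_fibers (k := m + 1) f hfib hY
end

section
/- Let $X$ be a compact metric space, $0 \leq p < q \leq 1$, and $n \geq 1$. Let $H(p,q,n)$ be the set of continuous maps $f : X \to [0,1]$ for which there exists a continuum $F \subseteq X$ with $[p,q] \subseteq f(F)$ such that for every $d \in [p,q]$ there is a connected component of $f^{-1}(d)$ intersecting $F$ and containing a point $x$ with $\mathrm{dist}(x, F) \geq 1/n$. Then $H(p,q,n)$ is a closed subset of $C(X,[0,1])$ with the uniform (sup) metric. -/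
open Set Metric

open TopologicalSpace Topology

theorem isClosed_setOf_isPreconnected_coe {X : Type*} [TopologicalSpace X] [T2Space X]
    [NormalSpace X] :
    IsClosed {K : NonemptyCompacts X | IsPreconnected (K : Set X)} := by
  refine isOpen_compl_iff.1 (isOpen_iff_mem_nhds.2 fun K hK => ?_)
  simp only [mem_compl_iff, mem_ofPred_eq] at hK
  rw [isPreconnected_iff_subset_of_fully_disjoint_closed K.isCompact.isClosed] at hK
  push Not at hK
  obtain ⟨u, v, hu, hv, hKuv, huv, hKu, hKv⟩ := hK
  obtain ⟨U, V, hU, hV, huU, hvV, hUV⟩ := normal_separation hu hv huv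
  obtain ⟨a, ha, hau⟩ := not_subset.1 hKu
  obtain ⟨b, hb, hbv⟩ := not_subset.1 hKv
  have hsub : {L : NonemptyCompacts X | (L : Set X) ⊆ U ∪ V} ∈ 𝓝 K :=
    (NonemptyCompacts.isOpen_subsets_of_isOpen (hU.union hV)).mem_nhds
      (hKuv.trans (union_subset_union huU hvV))
  have hmeetU : {L : NonemptyCompacts X | ((L : Set X) ∩ U).Nonempty} ∈ 𝓝 K :=
    (NonemptyCompacts.isOpen_inter_nonempty_of_isOpen hU).mem_nhds
      ⟨b, hb, huU ((hKuv hb).resolve_right hbv)⟩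
  have hmeetV : {L : NonemptyCompacts X | ((L : Set X) ∩ V).Nonempty} ∈ 𝓝 K :=
    (NonemptyCompacts.isOpen_inter_nonempty_of_isOpen hV).mem_nhds
      ⟨a, ha, hvV ((hKuv ha).resolve_left hau)⟩
  filter_upwards [hsub, hmeetU, hmeetV] with L hL hLU hLV hLc
  obtain ⟨x, -, hxU, hxV⟩ := hLc U V hU hV hL hLU hLV
  exact hUV.le_bot ⟨hxU, hxV⟩

theorem isClosed_setOf_mem_coe {X : Type*} [TopologicalSpace X] [T2Space X] :
    IsClosed {p : X × NonemptyCompacts X | p.1 ∈ (p.2 : Set X)} := by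
  refine isOpen_compl_iff.1 (isOpen_iff_mem_nhds.2 fun ⟨x, K⟩ hx => ?_)
  obtain ⟨U, V, hU, hV, hxU, hKV, hUV⟩ :=
    SeparatedNhds.of_isCompact_isCompact (isCompact_singleton (x := x)) K.isCompact
      (disjoint_singleton_left.2 hx)
  filter_upwards [prod_mem_nhds (hU.mem_nhds (hxU rfl))
    ((NonemptyCompacts.isOpen_subsets_of_isOpen hV).mem_nhds hKV)] with p hp hmem
  exact hUV.le_bot ⟨hp.1, hp.2 hmem⟩

theorem isClosed_setOf_coe_subset_preimage_singleton {X Y : Type*} [TopologicalSpace X]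
    [LocallyCompactSpace X] [TopologicalSpace Y] [T1Space Y] (d : Y) :
    IsClosed {p : C(X, Y) × NonemptyCompacts X | (p.2 : Set X) ⊆ ⇑p.1 ⁻¹' {d}} := by
  refine isOpen_compl_iff.1 (isOpen_iff_mem_nhds.2 fun ⟨f, K⟩ hK => ?_)
  obtain ⟨z, hz, hzd⟩ := not_subset.1 hK
  have hev : {p : C(X, Y) × X | p.1 p.2 ≠ d} ∈ 𝓝 (f, z) :=
    (isOpen_compl_singleton.preimage (by fun_prop)).mem_nhds hzd
  obtain ⟨A, hA, B, hB, hAB⟩ := mem_nhds_prod_iff.1 hev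
  obtain ⟨U, hUB, hU, hzU⟩ := mem_nhds_iff.1 hB
  filter_upwards [prod_mem_nhds hA ((NonemptyCompacts.isOpen_inter_nonempty_of_isOpen hU).mem_nhds
    ⟨z, hz, hzU⟩)] with p hp hsub
  obtain ⟨hpA, w, hw, hwU⟩ := hp
  exact hAB (show (p.1, w) ∈ A ×ˢ B from ⟨hpA, hUB hwU⟩) (hsub hw)

theorem IsClosed.isClosed_connectedComponentIn {X : Type*} [TopologicalSpace X] {s : Set X}
    (hs : IsClosed s) (x : X) : IsClosed (connectedComponentIn s x) := by
  by_cases hx : x ∈ s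
  · exact isClosed_of_closure_subset <|
      isPreconnected_connectedComponentIn.closure.subset_connectedComponentIn
        (subset_closure (mem_connectedComponentIn hx))
        (closure_minimal (connectedComponentIn_subset s x) hs)
  · rw [connectedComponentIn_eq_empty hx]
    exact isClosed_empty

/-- Some continuum in the fibre of `f` over `d` meets `F` and contains a point at distance at
least `r` from `F`. -/
def FibreContinuumReaches {X Y : Type*} [MetricSpace X] [TopologicalSpace Y] (r : ℝ) (d : Y)
    (f : C(X, Y)) (F : NonemptyCompacts X) : Prop :=
  ∃ t : NonemptyCompacts X × X × X, IsPreconnected (t.1 : Set X) ∧ (t.1 : Set X) ⊆ ⇑f ⁻¹' {d} ∧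
    t.2.1 ∈ (t.1 : Set X) ∧ t.2.1 ∈ (F : Set X) ∧ t.2.2 ∈ (t.1 : Set X) ∧ r ≤ infDist t.2.2 F

theorem isClosed_setOf_fibreContinuumReaches {X Y : Type*} [MetricSpace X] [CompactSpace X]
    [TopologicalSpace Y] [T1Space Y] (r : ℝ) (d : Y) :
    IsClosed {p : C(X, Y) × NonemptyCompacts X | FibreContinuumReaches r d p.1 p.2} := by
  have hcl : IsClosed {s : (C(X, Y) × NonemptyCompacts X) × NonemptyCompacts X × X × X |
      IsPreconnected (s.2.1 : Set X) ∧ (s.2.1 : Set X) ⊆ ⇑s.1.1 ⁻¹' {d} ∧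
      s.2.2.1 ∈ (s.2.1 : Set X) ∧ s.2.2.1 ∈ (s.1.2 : Set X) ∧ s.2.2.2 ∈ (s.2.1 : Set X) ∧
      r ≤ infDist s.2.2.2 s.1.2} := by
    refine (isClosed_setOf_isPreconnected_coe.preimage (by fun_prop)).inter <|
      ((isClosed_setOf_coe_subset_preimage_singleton d).preimage
        (f := fun s : (C(X, Y) × NonemptyCompacts X) × NonemptyCompacts X × X × X =>
          (s.1.1, s.2.1)) (by fun_prop)).inter <|
      (isClosed_setOf_mem_coe.preimage
        (f := fun s : (C(X, Y) × NonemptyCompacts X) × NonemptyCompacts X × X × X =>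
          (s.2.2.1, s.2.1)) (by fun_prop)).inter <|
      (isClosed_setOf_mem_coe.preimage
        (f := fun s : (C(X, Y) × NonemptyCompacts X) × NonemptyCompacts X × X × X =>
          (s.2.2.1, s.1.2)) (by fun_prop)).inter <|
      (isClosed_setOf_mem_coe.preimage
        (f := fun s : (C(X, Y) × NonemptyCompacts X) × NonemptyCompacts X × X × X =>
          (s.2.2.2, s.2.1)) (by fun_prop)).inter <|
      isClosed_le continuous_const
        (Metric.lipschitz_infDist.continuous.comp
        (f := fun s : (C(X, Y) × NonemptyCompacts X) × NonemptyCompacts X × X × X =>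
          (s.2.2.2, s.1.2)) (by fun_prop))
  convert isClosedMap_fst_of_compactSpace _ hcl using 1
  ext p
  simp only [FibreContinuumReaches, mem_ofPred_eq, mem_image, Prod.exists, exists_and_right,
    exists_eq_right]

theorem fibreContinuumReaches_iff {X Y : Type*} [MetricSpace X] [CompactSpace X]
    [TopologicalSpace Y] [T1Space Y] {r : ℝ} {d : Y} {f : C(X, Y)} {F : NonemptyCompacts X} :
    FibreContinuumReaches r d f F ↔ ∃ x₀ ∈ ⇑f ⁻¹' {d},
      (connectedComponentIn (⇑f ⁻¹' {d}) x₀ ∩ F).Nonempty ∧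
      ∃ x ∈ connectedComponentIn (⇑f ⁻¹' {d}) x₀, r ≤ infDist x F := by
  constructor
  · rintro ⟨⟨K, y, x⟩, hK, hKd, hyK, hyF, hxK, hx⟩
    have hsub := hK.subset_connectedComponentIn hyK hKd
    exact ⟨y, hKd hyK, ⟨y, hsub hyK, hyF⟩, x, hsub hxK, hx⟩
  · rintro ⟨x₀, hx₀, ⟨y, hy, hyF⟩, x, hx, hxr⟩
    have hclosed : IsClosed (connectedComponentIn (⇑f ⁻¹' {d}) x₀) :=
      (isClosed_singleton.preimage f.continuous).isClosed_connectedComponentIn x₀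
    exact ⟨⟨⟨⟨_, hclosed.isCompact⟩, ⟨y, hy⟩⟩, y, x⟩, isPreconnected_connectedComponentIn,
      connectedComponentIn_subset _ _, hy, hyF, hx, hxr⟩

theorem H_pqn_isClosed {X : Type*} [MetricSpace X] [CompactSpace X]
    (p q : unitInterval) (hpq : p < q) (n : ℕ) (hn : 1 ≤ n) :
    IsClosed {f : C(X, unitInterval) |
      ∃ F : Set X, IsCompact F ∧ IsConnected F ∧ Set.Icc p q ⊆ ⇑f '' F ∧
        ∀ d ∈ Set.Icc p q, ∃ x₀ ∈ ⇑f ⁻¹' {d},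
          (connectedComponentIn (⇑f ⁻¹' {d}) x₀ ∩ F).Nonempty ∧
          ∃ x ∈ connectedComponentIn (⇑f ⁻¹' {d}) x₀, (1 : ℝ) / n ≤ Metric.infDist x F} := by
  have hcl : IsClosed {s : C(X, unitInterval) × NonemptyCompacts X |
      IsPreconnected (s.2 : Set X) ∧
      ∀ d ∈ Set.Icc p q, FibreContinuumReaches ((1 : ℝ) / n) d s.1 s.2} := by
    convert ((isClosed_setOf_isPreconnected_coe (X := X)).preimage continuous_snd).inter
      (isClosed_biInter fun d (_ : d ∈ Icc p q) =>
        isClosed_setOf_fibreContinuumReaches (X := X) ((1 : ℝ) / n) d) using 1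
    ext s
    simp
  convert isClosedMap_fst_of_compactSpace _ hcl using 1
  ext f
  constructor
  · rintro ⟨F, hFc, hF, -, h⟩
    exact ⟨(f, ⟨⟨F, hFc⟩, hF.nonempty⟩), ⟨hF.isPreconnected,
      fun d hd => fibreContinuumReaches_iff.2 (h d hd)⟩, rfl⟩
  · rintro ⟨⟨f, F⟩, ⟨hF, h⟩, rfl⟩
    refine ⟨F, F.isCompact, ⟨F.nonempty, hF⟩, fun d hd => ?_,
      fun d hd => fibreContinuumReaches_iff.1 (h d hd)⟩
    obtain ⟨⟨K, y, x⟩, -, hKd, hyK, hyF, -⟩ := h d hd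
    exact ⟨y, hyF, hKd hyK⟩
end

section
/- Let $Y$ be a compact metric space. Then there exists a $\sigma$-compact zero-dimensional subset $A \subseteq Y \times [0,1]$ such that for every $y \in Y$, the set $(\{y\} \times [0,1]) \setminus A$ is zero-dimensional; equivalently, the restriction of the projection $p : Y \times [0,1] \to Y$ to $(Y \times [0,1]) \setminus A$ has all fibers zero-dimensional. -/
open Set Metric

open Topology

/-- A second countable space with a basis of clopen sets has covering dimension zero. -/
theorem covDimLE_zero_of_exists_isClopen {X : Type*} [TopologicalSpace X]
    [SecondCountableTopology X]
    (h : ∀ (x : X) (U : Set X), IsOpen U → x ∈ U → ∃ C, IsClopen C ∧ x ∈ C ∧ C ⊆ U) :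
    CovDimLE X 0 := by
  intro ι U hU hcov
  rcases isEmpty_or_nonempty X with hX | hX
  · exact ⟨Empty, fun _ => ∅, fun j => j.elim, Subsingleton.elim _ _, fun j => j.elim,
      fun x => isEmptyElim x⟩
  have hcov' (x : X) : ∃ i, x ∈ U i := by simpa using hcov.ge (mem_univ x)
  choose i hi using hcov'
  choose C hC hxC hCU using fun x => h x (U (i x)) (hU _) (hi x)
  obtain ⟨s, hs, hsU⟩ :=
    TopologicalSpace.countable_cover_nhds fun x => (hC x).isOpen.mem_nhds (hxC x)
  have hne : s.Nonempty := by
    by_contra hne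
    rw [not_nonempty_iff_eq_empty] at hne
    subst hne
    exact empty_ne_univ (by simpa using hsU)
  obtain ⟨g, rfl⟩ := hs.exists_eq_range hne
  have hex (x : X) : ∃ n, x ∈ C (g n) := by simpa using hsU.ge (mem_univ x)
  refine ⟨ℕ, fun n => C (g n) \ ⋃ m ∈ Iio n, C (g m), fun n => ?_, ?_, fun n => ?_, fun x => ?_⟩
  · exact (hC _).isOpen.sdiff ((finite_Iio n).isClosed_biUnion fun m _ => (hC _).isClosed)
  · classical
    refine eq_univ_of_forall fun x => mem_iUnion.2 ⟨Nat.find (hex x), Nat.find_spec (hex x), ?_⟩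
    simp only [mem_iUnion, mem_Iio, not_exists]
    exact fun m hm => Nat.find_min (hex x) hm
  · exact ⟨i (g n), sdiff_subset.trans (hCU _)⟩
  · have hsub : {n | x ∈ C (g n) \ ⋃ m ∈ Iio n, C (g m)}.Subsingleton := by
      rintro n ⟨hn, hn'⟩ m ⟨hm, hm'⟩
      simp only [mem_iUnion, mem_Iio, not_exists] at hn' hm'
      rcases lt_trichotomy n m with hlt | heq | hlt
      · exact absurd hn (hm' n hlt)
      · exact heq
      · exact absurd hm (hn' m hlt)
    exact ⟨hsub.finite, (ncard_le_one hsub.finite).2 fun a ha b hb => hsub ha hb⟩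

theorem IsClosed.exists_isOpen_disjoint_closure {X : Type*} [TopologicalSpace X] [NormalSpace X]
    {s t : Set X} (hs : IsClosed s) (ht : IsClosed t) (hst : Disjoint s t) :
    ∃ u v, IsOpen u ∧ IsOpen v ∧ s ⊆ u ∧ t ⊆ v ∧ Disjoint (closure u) (closure v) := by
  obtain ⟨u, hu, hsu, hut⟩ :=
    normal_exists_closure_subset hs ht.isOpen_compl hst.subset_compl_right
  obtain ⟨v, hv, htv, hvu⟩ :=
    normal_exists_closure_subset ht isClosed_closure.isOpen_compl (subset_compl_comm.1 hut)
  exact ⟨u, v, hu, hv, hsu, htv, disjoint_left.2 fun x hx hx' => hvu hx' hx⟩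

/-- Disjoint closed sets have open neighbourhoods with disjoint closures which together cover a
given embedded zero-dimensional compact set. -/
theorem exists_isOpen_disjoint_closure_range_subset {X Z : Type*} [TopologicalSpace X]
    [NormalSpace X] [T2Space X] [TopologicalSpace Z] [CompactSpace Z] [T2Space Z]
    [TotallyDisconnectedSpace Z] {e : Z → X} (he : Continuous e) (hinj : Function.Injective e)
    {s t : Set X} (hs : IsClosed s) (ht : IsClosed t) (hst : Disjoint s t) :
    ∃ u v, IsOpen u ∧ IsOpen v ∧ s ⊆ u ∧ t ⊆ v ∧ range e ⊆ u ∪ v ∧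
      Disjoint (closure u) (closure v) := by
  obtain ⟨D, hD, hsD, hDt⟩ := exists_clopen_of_closed_subset_open (hs.preimage he)
    (ht.isOpen_compl.preimage he) (preimage_mono hst.subset_compl_right)
  have hcl := (he.isClosedEmbedding hinj).isClosedMap
  obtain ⟨u, v, hu, hv, hsu, htv, huv⟩ := IsClosed.exists_isOpen_disjoint_closure
    (hs.union (hcl D hD.isClosed)) (ht.union (hcl Dᶜ hD.compl.isClosed)) (by
      simp only [disjoint_union_left, disjoint_union_right]
      refine ⟨⟨hst, ?_⟩, ?_, ?_⟩
      · exact disjoint_left.2 (forall_mem_image.2 fun z hz hx => hDt hz hx)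
      · exact disjoint_right.2 (forall_mem_image.2 fun z hz hx => hz (hsD hx))
      · exact (disjoint_image_iff hinj).2 disjoint_compl_right)
  refine ⟨u, v, hu, hv, subset_union_left.trans hsu, subset_union_left.trans htv, ?_, huv⟩
  rintro _ ⟨z, rfl⟩
  by_cases hz : z ∈ D
  · exact .inl (hsu (.inr ⟨z, hz, rfl⟩))
  · exact .inr (htv (.inr ⟨z, hz, rfl⟩))

/-- In a space covered by countably many embedded zero-dimensional compact sets, disjoint closed
sets are separated by a clopen set. -/
theorem exists_isClopen_of_iUnion_range_eq_univ {X Z : Type*} [TopologicalSpace X]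
    [NormalSpace X] [T2Space X] [TopologicalSpace Z] [CompactSpace Z] [T2Space Z]
    [TotallyDisconnectedSpace Z] {e : ℕ → Z → X} (he : ∀ n, Continuous (e n))
    (hinj : ∀ n, Function.Injective (e n)) (hcov : ⋃ n, range (e n) = univ)
    {s t : Set X} (hs : IsClosed s) (ht : IsClosed t) (hst : Disjoint s t) :
    ∃ C, IsClopen C ∧ s ⊆ C ∧ Disjoint C t := by
  let P := {p : Set X × Set X // IsOpen p.1 ∧ IsOpen p.2 ∧ Disjoint (closure p.1) (closure p.2)}
  have step (n : ℕ) (p : P) : ∃ q : P, p.1.1 ⊆ q.1.1 ∧ p.1.2 ⊆ q.1.2 ∧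
      range (e n) ⊆ q.1.1 ∪ q.1.2 := by
    obtain ⟨u, v, hu, hv, hsu, htv, hr, huv⟩ := exists_isOpen_disjoint_closure_range_subset
      (he n) (hinj n) isClosed_closure isClosed_closure p.2.2.2
    exact ⟨⟨(u, v), hu, hv, huv⟩, subset_closure.trans hsu, subset_closure.trans htv, hr⟩
  choose F hF₁ hF₂ hF using step
  obtain ⟨u, v, hu, hv, hsu, htv, huv⟩ := hs.exists_isOpen_disjoint_closure ht hst
  let q : ℕ → P := fun n => Nat.rec ⟨(u, v), hu, hv, huv⟩ F n
  have hmono₁ : Monotone fun n => (q n).1.1 := monotone_nat_of_le_succ fun n => hF₁ n (q n)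
  have hmono₂ : Monotone fun n => (q n).1.2 := monotone_nat_of_le_succ fun n => hF₂ n (q n)
  have hdisj : Disjoint (⋃ n, (q n).1.1) (⋃ n, (q n).1.2) := by
    simp only [disjoint_iUnion_left, disjoint_iUnion_right]
    exact fun n m => ((q (max m n)).2.2.2.mono subset_closure subset_closure).mono
      (hmono₁ (le_max_left _ _)) (hmono₂ (le_max_right _ _))
  have hcompl : (⋃ n, (q n).1.1)ᶜ = ⋃ n, (q n).1.2 := by
    refine Subset.antisymm (fun x hx => ?_) hdisj.subset_compl_left
    obtain ⟨n, hn⟩ := mem_iUnion.1 (hcov.ge (mem_univ x))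
    rcases hF n (q n) hn with h | h
    · exact absurd (mem_iUnion.2 ⟨n + 1, h⟩) hx
    · exact mem_iUnion.2 ⟨n + 1, h⟩
  refine ⟨⋃ n, (q n).1.1, ⟨?_, isOpen_iUnion fun n => (q n).2.1⟩,
    hsu.trans (subset_iUnion (fun n => (q n).1.1) 0),
    hdisj.mono_right (htv.trans (subset_iUnion (fun n => (q n).1.2) 0))⟩
  rw [← isOpen_compl_iff, hcompl]
  exact isOpen_iUnion fun n => (q n).2.2.1

/-- A space embedding into the line with dense complement has covering dimension zero. -/
theorem Topology.IsEmbedding.covDimLE_zero {X : Type*} [TopologicalSpace X] {g : X → ℝ}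
    (hg : IsEmbedding g) (hdense : ∀ a b : ℝ, a < b → ∃ t ∈ Ioo a b, t ∉ range g) :
    CovDimLE X 0 := by
  have := hg.secondCountableTopology
  refine covDimLE_zero_of_exists_isClopen fun x U hU hx => ?_
  obtain ⟨V, hV, rfl⟩ := hg.isOpen_iff.1 hU
  obtain ⟨ε, hε, hball⟩ := Metric.isOpen_iff.1 hV (g x) hx
  rw [Real.ball_eq_Ioo] at hball
  obtain ⟨a, ha, hag⟩ := hdense (g x - ε) (g x) (by linarith)
  obtain ⟨b, hb, hbg⟩ := hdense (g x) (g x + ε) (by linarith)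
  have heq : g ⁻¹' Ioo a b = g ⁻¹' Icc a b := by
    ext z
    have hza : a ≠ g z := fun h => hag ⟨z, h.symm⟩
    have hzb : g z ≠ b := fun h => hbg ⟨z, h⟩
    simp [le_iff_lt_or_eq, hza, hzb]
  refine ⟨g ⁻¹' Ioo a b, ⟨?_, isOpen_Ioo.preimage hg.continuous⟩, ⟨ha.2, hb.1⟩,
    preimage_mono ((Ioo_subset_Ioo ha.1.le hb.2.le).trans hball)⟩
  rw [heq]
  exact isClosed_Icc.preimage hg.continuous

/-- There is a sequence of Cantor sets in the unit interval such that every nondegenerate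
subinterval contains one of them. -/
theorem unitInterval.exists_seq_cantor : ∃ c : ℕ → (ℕ → Bool) → unitInterval,
    (∀ n, Continuous (c n) ∧ Function.Injective (c n)) ∧
    ∀ a b : unitInterval, a < b → ∃ n, ∀ s, c n s ∈ Icc a b := by
  have key (q : {q : ℚ × ℚ // 0 ≤ q.1 ∧ q.1 < q.2 ∧ q.2 ≤ 1}) :
      ∃ f : (ℕ → Bool) → unitInterval, (Continuous f ∧ Function.Injective f) ∧
        ∀ s, (f s : ℝ) ∈ Icc (q.1.1 : ℝ) q.1.2 := by
    obtain ⟨⟨a, b⟩, ha, hab, hb⟩ := q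
    have ha' : (0 : ℝ) ≤ a := by exact_mod_cast ha
    have hab' : (a : ℝ) < b := by exact_mod_cast hab
    have hb' : (b : ℝ) ≤ 1 := by exact_mod_cast hb
    have hunc : ¬ (Icc (a : ℝ) b).Countable := by
      rw [← Cardinal.le_aleph0_iff_set_countable, Cardinal.mk_Icc_real hab', not_le]
      exact Cardinal.aleph0_lt_continuum
    obtain ⟨f, hf, hfc, hfi⟩ := isClosed_Icc.exists_nat_bool_injection_of_not_countable hunc
    have hmem (s) : f s ∈ Icc (a : ℝ) b := hf ⟨s, rfl⟩
    exact ⟨fun s => ⟨f s, ha'.trans (hmem s).1, (hmem s).2.trans hb'⟩,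
      ⟨hfc.subtype_mk _, fun s t hst => hfi (congrArg Subtype.val hst)⟩, hmem⟩
  choose f hf hmem using key
  have : Nonempty {q : ℚ × ℚ // 0 ≤ q.1 ∧ q.1 < q.2 ∧ q.2 ≤ 1} := ⟨⟨(0, 1), by norm_num⟩⟩
  obtain ⟨g, hg⟩ := exists_surjective_nat {q : ℚ × ℚ // 0 ≤ q.1 ∧ q.1 < q.2 ∧ q.2 ≤ 1}
  refine ⟨fun n => f (g n), fun n => hf _, fun a b hab => ?_⟩
  have hab' : (a : ℝ) < b := hab
  obtain ⟨p, hap, hpb⟩ := exists_rat_btwn hab'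
  obtain ⟨q, hpq, hqb⟩ := exists_rat_btwn hpb
  obtain ⟨n, hn⟩ := hg ⟨(p, q), by exact_mod_cast a.2.1.trans hap.le, by exact_mod_cast hpq,
    by exact_mod_cast hqb.le.trans b.2.2⟩
  refine ⟨n, fun s => ?_⟩
  have h := hmem (g n) s
  beta_reduce
  rw [hn] at h ⊢
  exact ⟨hap.le.trans h.1, h.2.trans hqb.le⟩

theorem sigma_compact_zero_dim_complement {Y : Type*} [MetricSpace Y] [CompactSpace Y] :
    ∃ A : Set (Y × unitInterval),
      (∃ K : ℕ → Set (Y × unitInterval), (∀ i, IsCompact (K i)) ∧ A = ⋃ i, K i) ∧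
      CovDimLE ↥A 0 ∧
      ∀ y : Y, CovDimLE ↥({p : Y × unitInterval | p.1 = y} \ A) 0 := by
  rcases isEmpty_or_nonempty Y with hY | hY
  · exact ⟨∅, ⟨fun _ => ∅, fun _ => isCompact_empty, by simp⟩,
      covDimLE_zero_of_exists_isClopen fun x => x.2.elim, fun y => isEmptyElim y⟩
  obtain ⟨f, hf, hsurj⟩ := exists_nat_bool_continuous_surjective_of_compact Y
  obtain ⟨c, hc, hcI⟩ := unitInterval.exists_seq_cantor
  let e (n : ℕ) (s : ℕ → Bool) : Y × unitInterval := (f s, c n s)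
  have he (n : ℕ) : Continuous (e n) := hf.prodMk (hc n).1
  refine ⟨⋃ n, range (e n), ⟨fun n => range (e n), fun n => isCompact_range (he n), rfl⟩, ?_,
    fun y => ?_⟩
  · refine covDimLE_zero_of_exists_isClopen fun x U hU hx => ?_
    let e' (n : ℕ) (s : ℕ → Bool) : ↥(⋃ n, range (e n)) := ⟨e n s, mem_iUnion.2 ⟨n, s, rfl⟩⟩
    obtain ⟨C, hC, hxC, hCU⟩ := exists_isClopen_of_iUnion_range_eq_univ (e := e')
      (fun n => (he n).subtype_mk _)
      (fun n s t hst => (hc n).2 (congrArg (fun p => p.1.2) hst))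
      (eq_univ_of_forall fun ⟨p, hp⟩ => by
        obtain ⟨n, s, rfl⟩ := mem_iUnion.1 hp
        exact mem_iUnion.2 ⟨n, s, rfl⟩)
      (isClosed_singleton (x := x)) hU.isClosed_compl (by simpa using hx)
    exact ⟨C, hC, hxC rfl, disjoint_compl_right_iff_subset.1 hCU⟩
  · let g (p : ↥({p : Y × unitInterval | p.1 = y} \ ⋃ n, range (e n))) : ℝ := p.1.2
    have hg : Isometry g := Isometry.of_dist_eq fun p q => by
      have hpq : p.1.1 = q.1.1 := p.2.1.trans q.2.1.symm
      rw [Subtype.dist_eq, Prod.dist_eq, hpq, dist_self, max_eq_right dist_nonneg]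
      rfl
    refine hg.isEmbedding.covDimLE_zero fun a b hab => ?_
    by_contra! hall
    obtain ⟨p, hp⟩ := hall ((2 * a + b) / 3) ⟨by linarith, by linarith⟩
    obtain ⟨q, hq⟩ := hall ((a + 2 * b) / 3) ⟨by linarith, by linarith⟩
    have hp' : (p.1.2 : ℝ) = (2 * a + b) / 3 := hp
    have hq' : (q.1.2 : ℝ) = (a + 2 * b) / 3 := hq
    have hpq : p.1.2 < q.1.2 := Subtype.coe_lt_coe.1 (by linarith)
    obtain ⟨n, hn⟩ := hcI _ _ hpq
    obtain ⟨s, rfl⟩ := hsurj y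
    have h₁ : (p.1.2 : ℝ) ≤ c n s := (hn s).1
    have h₂ : (c n s : ℝ) ≤ q.1.2 := (hn s).2
    obtain ⟨r, hr⟩ := hall (c n s) ⟨by linarith, by linarith⟩
    exact r.2.2 (mem_iUnion.2 ⟨n, s, Prod.ext r.2.1.symm (Subtype.ext hr.symm)⟩)
end

section
/- Let $X$ be a compact metric space and $K$ a CW-complex, and suppose $f : X \to [0,1]$ is a continuous map such that every fiber $f^{-1}(t)$ has the property that any continuous map from a closed subset of $f^{-1}(t)$ to $K$ extends continuously over $f^{-1}(t)$ (i.e., e-dim $f^{-1}(t) \leq K$). Assume further the restricted statement for covering dimension: $K = S^{n}$, so each fiber has covering dimension at most $n$. Then $X$ has covering dimension at most $n+1$. -/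
open Set Metric

/-- Relatively open sets of a compact subset extend to ambient open sets without increasing the
order: a point of the extended set has its nearest points in the original set. -/
theorem exists_open_refinement_near_compact {X : Type*} [MetricSpace X] {n : ℕ} {F : Set X}
    (hF : IsCompact F) (hdim : CovDimLE ↥F n) {ι : Type} (U : ι → Set X)
    (hU : ∀ i, IsOpen (U i)) (hFU : F ⊆ ⋃ i, U i) :
    ∃ (m : ℕ) (P : Fin m → Set X) (r : Fin m → ι), (∀ p, IsOpen (P p)) ∧
      (∀ p, P p ⊆ U (r p)) ∧ F ⊆ ⋃ p, P p ∧ ∀ x, {p | x ∈ P p}.encard ≤ n + 1 := by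
  obtain ⟨κ, V, hVo, hVc, hVU, hVn⟩ := hdim ι (fun i => Subtype.val ⁻¹' U i)
    (fun i => (hU i).preimage continuous_subtype_val) (by
      ext x
      simpa using hFU x.2)
  choose r hr using hVU
  let O : κ → Set X := fun j =>
    {x | infEDist x F < infEDist x (F \ (Subtype.val '' V j))} ∩ U (r j)
  have hOo : ∀ j, IsOpen (O j) := fun j =>
    (isOpen_lt continuous_infEDist continuous_infEDist).inter (hU _)
  have hFO : F ⊆ ⋃ j, O j := by
    intro x hx
    have hmem : (⟨x, hx⟩ : F) ∈ ⋃ j, V j := hVc ▸ mem_univ _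
    obtain ⟨j, hj⟩ := mem_iUnion.1 hmem
    refine mem_iUnion.2 ⟨j, ?_, hr j hj⟩
    obtain ⟨G, hGo, hG⟩ := isOpen_induced_iff.1 (hVo j)
    have hxG : x ∈ G := by
      have : (⟨x, hx⟩ : F) ∈ Subtype.val ⁻¹' G := hG ▸ hj
      exact this
    have hdiff : F \ (Subtype.val '' V j) ⊆ Gᶜ := by
      rintro y ⟨hyF, hy⟩ hyG
      exact hy ⟨⟨y, hyF⟩, hG ▸ hyG, rfl⟩
    have hpos : 0 < infEDist x Gᶜ := by
      rw [pos_iff_ne_zero]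
      intro h0
      have := (mem_iff_infEDist_zero_of_closed hGo.isClosed_compl).2 h0
      exact this hxG
    change infEDist x F < _
    rw [infEDist_zero_of_mem hx]
    exact hpos.trans_le (infEDist_anti hdiff)
  have hOn : ∀ x, {j | x ∈ O j}.encard ≤ n + 1 := by
    intro x
    rcases F.eq_empty_or_nonempty with hF0 | hne
    · have : {j | x ∈ O j} = ∅ := by
        ext j
        simp [O, hF0]
      simp [this]
    · obtain ⟨y, hyF, hy⟩ := hF.exists_infEDist_eq_edist hne x
      have hsub : {j | x ∈ O j} ⊆ {j | (⟨y, hyF⟩ : F) ∈ V j} := by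
        intro j hj
        by_contra hyV
        have hlt : infEDist x F < infEDist x (F \ (Subtype.val '' V j)) := hj.1
        have hyd : y ∈ F \ (Subtype.val '' V j) := by
          refine ⟨hyF, ?_⟩
          rintro ⟨z, hz, hzy⟩
          obtain rfl : z = ⟨y, hyF⟩ := Subtype.ext hzy
          exact hyV hz
        exact absurd (infEDist_le_edist_of_mem hyd) (not_le.2 (hy ▸ hlt))
      refine (encard_le_encard hsub).trans ?_
      obtain ⟨hfin, hcard⟩ := hVn ⟨y, hyF⟩
      rw [← hfin.cast_ncard_eq]
      exact_mod_cast hcard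
  obtain ⟨s, hs⟩ := hF.elim_finite_subcover O hOo hFO
  let e := s.equivFin
  refine ⟨s.card, fun p => O (e.symm p), fun p => r (e.symm p), fun p => hOo _,
    fun p => inter_subset_right, ?_, ?_⟩
  · intro x hx
    obtain ⟨j, hjs, hj⟩ := mem_iUnion₂.1 (hs hx)
    exact mem_iUnion.2 ⟨e ⟨j, hjs⟩, by simpa using hj⟩
  · intro x
    refine le_trans ?_ (hOn x)
    have hinj : Function.Injective fun p => (e.symm p : κ) :=
      Subtype.val_injective.comp e.symm.injective
    rw [← hinj.encard_image]
    apply encard_le_encard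
    rintro _ ⟨p, hp, rfl⟩
    exact hp

/-- `U` has a precise open refinement covering `S` whose order on `S` is at most `N`. -/
def HasRefinementOn {X ι : Type*} [TopologicalSpace X] (U : ι → Set X) (N : ℕ) (S : Set X) :
    Prop :=
  ∃ V : ι → Set X, (∀ i, IsOpen (V i)) ∧ (∀ i, V i ⊆ U i) ∧ S ⊆ ⋃ i, V i ∧
    ∀ x ∈ S, {i | x ∈ V i}.encard ≤ N

theorem HasRefinementOn.mono {X ι : Type*} [TopologicalSpace X] {U : ι → Set X} {N : ℕ}
    {S T : Set X} (h : HasRefinementOn U N T) (hST : S ⊆ T) : HasRefinementOn U N S := by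
  obtain ⟨V, hVo, hVU, hV, hVn⟩ := h
  exact ⟨V, hVo, hVU, hST.trans hV, fun x hx => hVn x (hST hx)⟩

/-- Merging a family along a map of index sets does not increase its order. -/
theorem HasRefinementOn.of_indexed {X ι κ : Type*} [TopologicalSpace X] {U : ι → Set X} {N : ℕ}
    {S : Set X} (P : κ → Set X) (r : κ → ι) (hP : ∀ p, IsOpen (P p)) (hPU : ∀ p, P p ⊆ U (r p))
    (hS : S ⊆ ⋃ p, P p) (hN : ∀ x ∈ S, {p | x ∈ P p}.encard ≤ N) : HasRefinementOn U N S := by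
  refine ⟨fun i => ⋃ (p) (_ : r p = i), P p, fun i => isOpen_iUnion fun p => isOpen_iUnion
    fun _ => hP p, ?_, ?_, ?_⟩
  · rintro i x hx
    obtain ⟨p, rfl, hp⟩ := mem_iUnion₂.1 hx
    exact hPU p hp
  · intro x hx
    obtain ⟨p, hp⟩ := mem_iUnion.1 (hS hx)
    exact mem_iUnion.2 ⟨r p, mem_iUnion₂.2 ⟨p, rfl, hp⟩⟩
  · intro x hx
    refine le_trans ?_ (hN x hx)
    refine le_trans (encard_le_encard ?_) (encard_image_le r _)
    intro i hi
    obtain ⟨p, hpi, hp⟩ := mem_iUnion₂.1 hi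
    exact ⟨p, hp, hpi⟩

theorem exists_continuous_pos_iff_mem {X : Type*} [MetricSpace X] {O : Set X} (hO : IsOpen O) :
    ∃ l : X → ℝ, Continuous l ∧ (∀ x, 0 ≤ l x) ∧ ∀ x, 0 < l x ↔ x ∈ O := by
  rcases Oᶜ.eq_empty_or_nonempty with h | h
  · rw [compl_empty_iff] at h
    exact ⟨fun _ => 1, continuous_const, fun _ => zero_le_one, fun x => by simp [h]⟩
  · refine ⟨fun x => infDist x Oᶜ, continuous_infDist_pt _, fun _ => infDist_nonneg, fun x => ?_⟩
    rw [← hO.isClosed_compl.notMem_iff_infDist_pos h, notMem_compl_iff]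

/-- The stars of the vertices in the standard triangulation of a prism: at every point the two
families together have at most one member more than `P` does. -/
theorem exists_prism_families {X : Type*} [MetricSpace X] {m : ℕ} (P : Fin m → Set X)
    (hP : ∀ p, IsOpen (P p)) {h : X → ℝ} (hh : Continuous h) :
    ∃ B T : Fin m → Set X, (∀ p, IsOpen (B p)) ∧ (∀ p, IsOpen (T p)) ∧
      (∀ p, B p ∪ T p = P p) ∧ (∀ x, h x ≤ 0 → ∀ p, x ∉ B p) ∧ (∀ x, 1 ≤ h x → ∀ p, x ∉ T p) ∧
      ∀ x, {p | x ∈ B p}.encard + {p | x ∈ T p}.encard ≤ {p | x ∈ P p}.encard + 1 := by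
  choose l hlc hl0 hlP using fun p => exists_continuous_pos_iff_mem (hP p)
  let θ : X → ℝ := fun x => h x * ∑ q, l q x
  have hθ : Continuous θ := by fun_prop
  let B : Fin m → Set X := fun p => P p ∩ {x | ∑ q ∈ Finset.Iio p, l q x < θ x}
  let T : Fin m → Set X := fun p => P p ∩ {x | θ x < ∑ q ∈ Finset.Iic p, l q x}
  have hstep : ∀ x p, ∑ q ∈ Finset.Iic p, l q x = l p x + ∑ q ∈ Finset.Iio p, l q x := by
    intro x p
    rw [← Finset.Iio_insert, Finset.sum_insert (by simp)]
  have hBT : ∀ p, B p ∪ T p = P p := by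
    intro p
    rw [← inter_union_distrib_left, inter_eq_left]
    intro x hx
    have := (hlP p x).2 hx
    rcases lt_or_ge (∑ q ∈ Finset.Iio p, l q x) (θ x) with h1 | h1
    · exact Or.inl h1
    · right
      change θ x < _
      rw [hstep]
      linarith
  have hsum : ∀ x, 0 ≤ ∑ q, l q x := fun x => Finset.sum_nonneg fun q _ => hl0 q x
  refine ⟨B, T, fun p => (hP p).inter (isOpen_lt (by fun_prop) hθ),
    fun p => (hP p).inter (isOpen_lt hθ (by fun_prop)), hBT, ?_, ?_, ?_⟩
  · rintro x hx p ⟨-, hp⟩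
    have h1 : ∑ q ∈ Finset.Iio p, l q x < θ x := hp
    have h2 : 0 ≤ ∑ q ∈ Finset.Iio p, l q x := Finset.sum_nonneg fun q _ => hl0 q x
    have h3 : θ x ≤ 0 := mul_nonpos_of_nonpos_of_nonneg hx (hsum x)
    linarith
  · rintro x hx p ⟨-, hp⟩
    have h1 : θ x < ∑ q ∈ Finset.Iic p, l q x := hp
    have h2 : ∑ q ∈ Finset.Iic p, l q x ≤ ∑ q, l q x :=
      Finset.sum_le_sum_of_subset_of_nonneg (Finset.subset_univ _) fun q _ _ => hl0 q x
    have h3 : ∑ q, l q x ≤ θ x := le_mul_of_one_le_left (hsum x) hx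
    linarith
  · intro x
    rw [← encard_union_add_encard_inter]
    have hnot : ∀ p q, p < q → x ∈ T p → x ∉ B q := by
      rintro p q hpq ⟨-, hp⟩ ⟨-, hq⟩
      have h1 : θ x < ∑ q ∈ Finset.Iic p, l q x := hp
      have h2 : ∑ q ∈ Finset.Iio q, l q x < θ x := hq
      have h3 : ∑ q ∈ Finset.Iic p, l q x ≤ ∑ q ∈ Finset.Iio q, l q x :=
        Finset.sum_le_sum_of_subset_of_nonneg
          (fun k hk => Finset.mem_Iio.2 ((Finset.mem_Iic.1 hk).trans_lt hpq)) fun q _ _ => hl0 q x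
      linarith
    gcongr
    · rintro p (hp | hp)
      · exact hp.1
      · exact hp.1
    · rw [encard_le_one_iff]
      rintro p q ⟨hpB, hpT⟩ ⟨hqB, hqT⟩
      rcases lt_trichotomy p q with hpq | hpq | hpq
      · exact absurd hqB (hnot p q hpq hpT)
      · exact hpq
      · exact absurd hpB (hnot q p hpq hqT)

theorem exists_pos_preimage_subset {X : Type*} [TopologicalSpace X] [CompactSpace X] {g : X → ℝ}
    (hg : Continuous g) {a : ℝ} {O : Set X} (hO : IsOpen O) (ha : g ⁻¹' {a} ⊆ O) :
    ∃ δ > 0, ∀ x, |g x - a| ≤ δ → x ∈ O := by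
  have hK : IsClosed (g '' Oᶜ) := (hO.isClosed_compl.isCompact.image hg).isClosed
  have haK : a ∈ (g '' Oᶜ)ᶜ := by
    rintro ⟨x, hx, rfl⟩
    exact hx (ha rfl)
  obtain ⟨ε, hε, hball⟩ := Metric.isOpen_iff.1 hK.isOpen_compl a haK
  refine ⟨ε / 2, half_pos hε, fun x hx => ?_⟩
  by_contra hxO
  refine hball ?_ ⟨x, hxO, rfl⟩
  rw [Metric.mem_ball, Real.dist_eq]
  linarith

/-- Refinements on both sides of a level set of dimension at most `n` can be glued, at the level
set, into a refinement whose order is at most `n + 2`. -/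
theorem HasRefinementOn.glue {X : Type*} [MetricSpace X] [CompactSpace X] {n : ℕ} {g : X → ℝ}
    (hg : Continuous g) {a b : ℝ} (hab : a ≤ b) (hdim : CovDimLE ↥(g ⁻¹' {a}) n) {ι : Type}
    {U : ι → Set X} (hV : HasRefinementOn U (n + 2) (g ⁻¹' Iic a))
    (hW : HasRefinementOn U (n + 2) (g ⁻¹' Icc a b)) :
    HasRefinementOn U (n + 2) (g ⁻¹' Iic b) := by
  obtain ⟨V, hVo, hVU, hVc, hVn⟩ := hV
  obtain ⟨W, hWo, hWU, hWc, hWn⟩ := hW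
  obtain ⟨m, P, r, hPo, hPr, hPc, hPn⟩ := exists_open_refinement_near_compact
    (isClosed_singleton.preimage hg).isCompact hdim (fun k : ι × ι => V k.1 ∩ W k.2)
    (fun k => (hVo _).inter (hWo _)) (by
      intro x hx
      have hxa : g x = a := hx
      obtain ⟨i, hi⟩ := mem_iUnion.1 (hVc (show g x ≤ a from hxa.le))
      obtain ⟨j, hj⟩ := mem_iUnion.1 (hWc (show g x ∈ Icc a b from ⟨hxa.ge, hxa ▸ hab⟩))
      exact mem_iUnion.2 ⟨(i, j), hi, hj⟩)
  obtain ⟨δ, hδ, hδP⟩ := exists_pos_preimage_subset hg (isOpen_iUnion hPo) hPc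
  obtain ⟨B, T, hBo, hTo, hBT, hB0, hT0, hn⟩ := exists_prism_families P hPo
    (h := fun x => (a + δ - g x) / (2 * δ)) (by fun_prop)
  have hBP : ∀ p, B p ⊆ P p := fun p => (hBT p) ▸ subset_union_left
  have hTP : ∀ p, T p ⊆ P p := fun p => (hBT p) ▸ subset_union_right
  have hBright : ∀ x, a + δ ≤ g x → ∀ p, x ∉ B p := fun x hx =>
    hB0 x (div_nonpos_of_nonpos_of_nonneg (by linarith) (by linarith))
  have hTleft : ∀ x, g x ≤ a - δ → ∀ p, x ∉ T p := fun x hx =>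
    hT0 x ((one_le_div (by linarith)).2 (by linarith))
  refine ⟨fun i => ((V i ∩ {x | g x < a - δ}) ∪ ⋃ (p) (_ : (r p).1 = i), B p) ∪
    ((W i ∩ {x | a + δ < g x}) ∪ ⋃ (p) (_ : (r p).2 = i), T p), ?_, ?_, ?_, ?_⟩
  · intro i
    exact (((hVo i).inter (isOpen_lt hg continuous_const)).union
      (isOpen_iUnion fun p => isOpen_iUnion fun _ => hBo p)).union
      (((hWo i).inter (isOpen_lt continuous_const hg)).union
      (isOpen_iUnion fun p => isOpen_iUnion fun _ => hTo p))
  · rintro i x ((⟨hx, -⟩ | hx) | (⟨hx, -⟩ | hx))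
    · exact hVU i hx
    · obtain ⟨p, rfl, hp⟩ := mem_iUnion₂.1 hx
      exact hVU _ (hPr p (hBP p hp)).1
    · exact hWU i hx
    · obtain ⟨p, rfl, hp⟩ := mem_iUnion₂.1 hx
      exact hWU _ (hPr p (hTP p hp)).2
  · intro x hxb
    rcases lt_or_ge (g x) (a - δ) with h1 | h1
    · obtain ⟨i, hi⟩ := mem_iUnion.1 (hVc (show g x ≤ a by linarith))
      exact mem_iUnion.2 ⟨i, Or.inl (Or.inl ⟨hi, h1⟩)⟩
    rcases lt_or_ge (a + δ) (g x) with h2 | h2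
    · obtain ⟨i, hi⟩ := mem_iUnion.1 (hWc (show g x ∈ Icc a b from ⟨by linarith, hxb⟩))
      exact mem_iUnion.2 ⟨i, Or.inr (Or.inl ⟨hi, h2⟩)⟩
    obtain ⟨p, hp⟩ := mem_iUnion.1 (hδP x (abs_le.2 ⟨by linarith, by linarith⟩))
    rw [← hBT p] at hp
    rcases hp with hp | hp
    · exact mem_iUnion.2 ⟨_, Or.inl (Or.inr (mem_iUnion₂.2 ⟨p, rfl, hp⟩))⟩
    · exact mem_iUnion.2 ⟨_, Or.inr (Or.inr (mem_iUnion₂.2 ⟨p, rfl, hp⟩))⟩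
  · intro x hxb
    rcases lt_or_ge (g x) (a - δ) with h1 | h1
    · refine (encard_le_encard ?_).trans (hVn x (show g x ≤ a by linarith))
      rintro i ((⟨hx, -⟩ | hx) | (⟨-, hx⟩ | hx))
      · exact hx
      · obtain ⟨p, rfl, hp⟩ := mem_iUnion₂.1 hx
        exact (hPr p (hBP p hp)).1
      · have : a + δ < g x := hx
        linarith
      · obtain ⟨p, rfl, hp⟩ := mem_iUnion₂.1 hx
        exact absurd hp (hTleft x h1.le p)
    rcases lt_or_ge (a + δ) (g x) with h2 | h2
    · refine (encard_le_encard ?_).trans (hWn x (show g x ∈ Icc a b from ⟨by linarith, hxb⟩))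
      rintro i ((⟨-, hx⟩ | hx) | (⟨hx, -⟩ | hx))
      · exact absurd hx (not_lt.2 h1)
      · obtain ⟨p, rfl, hp⟩ := mem_iUnion₂.1 hx
        exact absurd hp (hBright x h2.le p)
      · exact hx
      · obtain ⟨p, rfl, hp⟩ := mem_iUnion₂.1 hx
        exact (hPr p (hTP p hp)).2
    · calc _ ≤ ((fun p => (r p).1) '' {p | x ∈ B p} ∪
              (fun p => (r p).2) '' {p | x ∈ T p}).encard := by
            apply encard_le_encard
            rintro i ((⟨-, hx⟩ | hx) | (⟨-, hx⟩ | hx))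
            · exact absurd hx (not_lt.2 h1)
            · obtain ⟨p, hpi, hp⟩ := mem_iUnion₂.1 hx
              exact Or.inl ⟨p, hp, hpi⟩
            · exact absurd hx (not_lt.2 h2)
            · obtain ⟨p, hpi, hp⟩ := mem_iUnion₂.1 hx
              exact Or.inr ⟨p, hp, hpi⟩
        _ ≤ {p | x ∈ B p}.encard + {p | x ∈ T p}.encard :=
            (encard_union_le _ _).trans (add_le_add (encard_image_le _ _) (encard_image_le _ _))
        _ ≤ {p | x ∈ P p}.encard + 1 := hn x
        _ ≤ (n + 1) + 1 := add_le_add_left (hPn x) 1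
        _ = ((n + 2 : ℕ) : ℕ∞) := by norm_cast

theorem dim_le_succ_of_fibers {X : Type*} [MetricSpace X] [CompactSpace X] (n : ℕ)
    (f : C(X, unitInterval)) (hf : ∀ t : unitInterval, CovDimLE ↥(⇑f ⁻¹' {t}) n) :
    CovDimLE X (n + 1) := by
  intro ι U hUo hUc
  let g : X → ℝ := fun x => f x
  have hg : Continuous g := continuous_subtype_val.comp f.continuous
  have hfib : ∀ t : unitInterval, g ⁻¹' {(t : ℝ)} = f ⁻¹' {t} := by
    intro t
    ext x
    simp [g, Subtype.ext_iff]
  have hdim : ∀ t : unitInterval, CovDimLE ↥(g ⁻¹' {(t : ℝ)}) n := fun t => by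
    rw [hfib]
    exact hf t
  have hloc : ∀ t : unitInterval, ∃ δ > 0,
      HasRefinementOn U (n + 2) {x | |g x - t| ≤ δ} := by
    intro t
    obtain ⟨m, P, r, hPo, hPr, hPc, hPn⟩ := exists_open_refinement_near_compact
      (isClosed_singleton.preimage hg).isCompact (hdim t) U hUo (hUc ▸ subset_univ _)
    obtain ⟨δ, hδ, hδP⟩ := exists_pos_preimage_subset hg (isOpen_iUnion hPo) hPc
    refine ⟨δ, hδ, .of_indexed P r hPo hPr hδP fun x _ => (hPn x).trans ?_⟩
    norm_cast
    lia
  choose δ hδ hgood using hloc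
  obtain ⟨t, ht0, htm, ⟨M, hM⟩, ht⟩ := exists_monotone_Icc_subset_open_cover_unitInterval
    (c := fun s : unitInterval => ball s (δ s)) (fun s => isOpen_ball)
    (fun s _ => mem_iUnion.2 ⟨s, mem_ball_self (hδ s)⟩)
  have hslab : ∀ k, HasRefinementOn U (n + 2) (g ⁻¹' Icc (t k : ℝ) (t (k + 1))) := by
    intro k
    obtain ⟨s, hs⟩ := ht k
    refine (hgood s).mono fun x hx => ?_
    have : f x ∈ ball s (δ s) := hs ⟨hx.1, hx.2⟩
    rw [mem_ball, Subtype.dist_eq, Real.dist_eq] at this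
    exact this.le
  have hind : ∀ k, HasRefinementOn U (n + 2) (g ⁻¹' Iic (t k : ℝ)) := by
    intro k
    induction k with
    | zero =>
      refine (hslab 0).mono fun x hx => ⟨?_, le_trans hx (htm (Nat.zero_le 1))⟩
      rw [ht0]
      exact (f x).2.1
    | succ k ih => exact ih.glue hg (htm k.le_succ) (hdim (t k)) (hslab k)
  obtain ⟨V, hVo, hVU, hVc, hVn⟩ := hind M
  have huniv : ∀ x, x ∈ g ⁻¹' Iic (t M : ℝ) := by
    intro x
    rw [hM M le_rfl]
    exact (f x).2.2
  refine ⟨ι, V, hVo, eq_univ_of_forall fun x => hVc (huniv x), fun i => ⟨i, hVU i⟩, fun x => ?_⟩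
  have hfin : {i | x ∈ V i}.Finite := finite_of_encard_le_coe (hVn x (huniv x))
  refine ⟨hfin, ?_⟩
  have := hVn x (huniv x)
  rw [← hfin.cast_ncard_eq] at this
  exact_mod_cast this
end

section
/- Let $X$ be a compact metric space, $A \subseteq X$ closed with $\dim A = 0$, viewed inside the hyperspace setting: for every $\epsilon > 0$ and every continuous $f : X \to [0,1]$, and for the set $T$ of maps $g \in C(X,[0,1])$ such that every point of $A$ lies in a singleton (trivial) connected component of its fiber $g^{-1}(g(x))$ — the set $T$ is residual (comeager) in $C(X,[0,1])$. -/
open Set Metric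

open Topology

/-- In a separable metric space of covering dimension zero, every point has arbitrarily small
clopen neighbourhoods. -/
theorem CovDimLE.exists_isClopen_subset_ball {Y : Type*} [MetricSpace Y]
    [TopologicalSpace.SeparableSpace Y] (hdim : CovDimLE Y 0) (x : Y) {r : ℝ} (hr : 0 < r) :
    ∃ K : Set Y, IsClopen K ∧ x ∈ K ∧ ∃ y, K ⊆ ball y r := by
  have : Nonempty Y := ⟨x⟩
  obtain ⟨κ, V, hVo, hVc, hVU, hV⟩ := hdim ℕ
    (fun n => ball (TopologicalSpace.denseSeq Y n) r) (fun _ => isOpen_ball) (by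
      refine eq_univ_of_forall fun z => mem_iUnion.2 ?_
      exact (TopologicalSpace.denseRange_denseSeq Y).exists_dist_lt z hr)
  have cover : ∀ z, ∃ j, z ∈ V j := fun z => mem_iUnion.1 (hVc ▸ mem_univ z)
  have unique : ∀ z i j, z ∈ V i → z ∈ V j → i = j := fun z i j hi hj =>
    (ncard_le_one (hV z).1).1 (hV z).2 i hi j hj
  obtain ⟨j, hj⟩ := cover x
  refine ⟨V j, ⟨⟨?_⟩, hVo j⟩, hj, ?_⟩
  · have : (V j)ᶜ = ⋃ i ∈ {i | i ≠ j}, V i := by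
      ext z
      simp only [mem_compl_iff, mem_ofPred_eq, mem_iUnion, exists_prop]
      constructor
      · intro hz
        obtain ⟨i, hi⟩ := cover z
        exact ⟨i, fun h => hz (h ▸ hi), hi⟩
      · rintro ⟨i, hne, hi⟩ hz
        exact hne (unique z i j hi hz)
    rw [this]
    exact isOpen_biUnion fun i _ => hVo i
  · obtain ⟨n, hn⟩ := hVU j
    exact ⟨_, hn⟩

/-- Points of a closed zero-dimensional set have arbitrarily small open neighbourhoods in the
ambient space whose frontier misses that set. -/
theorem CovDimLE.exists_isOpen_frontier_disjoint {X : Type*} [MetricSpace X] [CompactSpace X]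
    {A : Set X} (hA : IsClosed A) (hdim : CovDimLE ↥A 0) {x : X} (hx : x ∈ A) {r : ℝ}
    (hr : 0 < r) :
    ∃ U : Set X, IsOpen U ∧ x ∈ U ∧ Disjoint A (frontier U) ∧ ∃ y, closure U ⊆ ball y r := by
  obtain ⟨K, hK, hxK, y, hKy⟩ := hdim.exists_isClopen_subset_ball ⟨x, hx⟩ hr
  have hK₁ : IsClosed ((↑) '' K : Set X) := hA.isClosedEmbedding_subtypeVal.isClosedMap _ hK.1
  have hK₂ : IsClosed ((↑) '' Kᶜ : Set X) :=
    hA.isClosedEmbedding_subtypeVal.isClosedMap _ hK.compl.1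
  have hsub : ((↑) '' K : Set X) ⊆ ball (y : X) r ∩ ((↑) '' Kᶜ : Set X)ᶜ := by
    rintro _ ⟨a, ha, rfl⟩
    refine ⟨hKy ha, ?_⟩
    rintro ⟨b, hb, hab⟩
    exact hb (Subtype.ext hab ▸ ha)
  obtain ⟨U, hU, hKU, hUO⟩ := normal_exists_closure_subset hK₁
    (isOpen_ball.inter hK₂.isOpen_compl) hsub
  refine ⟨U, hU, hKU ⟨_, hxK, rfl⟩, ?_, y, hUO.trans inter_subset_left⟩
  rw [disjoint_left]
  intro a ha haU
  rw [hU.frontier_eq] at haU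
  by_cases h : (⟨a, ha⟩ : A) ∈ K
  · exact haU.2 (hKU ⟨_, h, rfl⟩)
  · exact (hUO haU.1).2 ⟨_, h, rfl⟩

/-- The maps `g` for which every point of `A` has an open neighbourhood of size less than `ε` whose
frontier misses the fiber of `g` through that point. -/
def mapsWithSmallSeparation {X : Type*} [MetricSpace X] (A : Set X) (ε : ℝ) :
    Set C(X, unitInterval) :=
  {g | ∀ x ∈ A, ∃ U : Set X, IsOpen U ∧ x ∈ U ∧ (∀ a ∈ U, ∀ b ∈ U, dist a b < ε) ∧
    ∀ y ∈ frontier U, g x ≠ g y}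

theorem isOpen_mapsWithSmallSeparation {X : Type*} [MetricSpace X] [CompactSpace X]
    {A : Set X} (hA : IsClosed A) (ε : ℝ) : IsOpen (mapsWithSmallSeparation A ε) := by
  rw [isOpen_iff_mem_nhds]
  intro g hg
  refine hA.isCompact.eventually_forall_of_forall_eventually fun x hx => ?_
  obtain ⟨U, hU, hxU, hd, hfr⟩ := hg x hx
  have h₁ : ∀ᶠ p : C(X, unitInterval) × X in 𝓝 (g, x), ∀ y ∈ frontier U, p.1 p.2 ≠ p.1 y := by
    refine isClosed_frontier.isCompact.eventually_forall_of_forall_eventually fun y hy => ?_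
    have h₁ : Continuous fun q : (C(X, unitInterval) × X) × X => q.1.1 q.1.2 := by fun_prop
    have h₂ : Continuous fun q : (C(X, unitInterval) × X) × X => q.1.1 q.2 := by fun_prop
    exact (isOpen_ne_fun h₁ h₂).mem_nhds (hfr y hy)
  have h₂ : ∀ᶠ p : C(X, unitInterval) × X in 𝓝 (g, x), p.2 ∈ U :=
    continuous_snd.continuousAt.eventually_mem (hU.mem_nhds hxU)
  filter_upwards [h₁, h₂] with p hp₁ hp₂
  exact ⟨U, hU, hp₂, hd, hp₁⟩

theorem dense_mapsWithSmallSeparation {X : Type*} [MetricSpace X] [CompactSpace X]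
    {A : Set X} (hA : IsClosed A) (hdim : CovDimLE ↥A 0) {ε : ℝ} (hε : 0 < ε) :
    Dense (mapsWithSmallSeparation A ε) := by
  rw [Metric.dense_iff]
  intro f s hs
  obtain ⟨c, hc₀, hc⟩ := exists_between (lt_min hs one_pos)
  obtain ⟨hcs, hc₁⟩ := lt_min_iff.1 hc
  obtain ⟨δ, hδ, hf⟩ := Metric.uniformContinuous_iff.1
    (CompactSpace.uniformContinuous_of_continuous f.continuous) c hc₀
  have hr : 0 < min δ ε / 2 := by positivity
  choose! U hU hxU hdisj y hy using
    fun x (hx : x ∈ A) => hdim.exists_isOpen_frontier_disjoint hA hx hr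
  have hsmall : ∀ x ∈ A, ∀ a ∈ closure (U x), ∀ b ∈ closure (U x), dist a b < min δ ε := by
    intro x hx a ha b hb
    have h₁ := mem_ball.1 (hy x hx ha)
    have h₂ := mem_ball.1 (hy x hx hb)
    linarith [dist_triangle_right a b (y x)]
  obtain ⟨t, htA, ht⟩ := hA.isCompact.elim_nhds_subcover U
    fun x hx => (hU x hx).mem_nhds (hxU x hx)
  have hclosed : IsClosed (⋃ x ∈ t, frontier (U x)) :=
    t.finite_toSet.isClosed_biUnion fun _ _ => isClosed_frontier
  obtain ⟨φ, hφ₀, hφ₁, hφ⟩ := exists_continuous_zero_one_of_isClosed hclosed hA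
    (disjoint_iUnion₂_left.2 fun x hx => (hdisj x (htA x hx)).symm)
  have hmem : ∀ z, (1 - c) * (f z : ℝ) + c * φ z ∈ unitInterval := by
    intro z
    have h₁ := (f z).2
    have h₂ := hφ z
    exact convex_Icc (0 : ℝ) 1 h₁ h₂ (by linarith) hc₀.le (by ring)
  let g : C(X, unitInterval) := ⟨fun z => ⟨(1 - c) * (f z : ℝ) + c * φ z, hmem z⟩, by fun_prop⟩
  refine ⟨g, ?_, ?_⟩
  · refine mem_ball.2 (lt_of_le_of_lt ((ContinuousMap.dist_le hc₀.le).2 fun z => ?_) hcs)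
    rw [Subtype.dist_eq, Real.dist_eq]
    have h : ((1 - c) * (f z : ℝ) + c * φ z) - f z = c * (φ z - f z) := by ring
    change |((1 - c) * (f z : ℝ) + c * φ z) - f z| ≤ c
    rw [h, abs_mul, abs_of_pos hc₀]
    refine mul_le_of_le_one_right hc₀.le (abs_le.2 ?_)
    have h₁ := (f z).2
    have h₂ := hφ z
    constructor <;> linarith [h₁.1, h₁.2, h₂.1, h₂.2]
  · intro a ha
    obtain ⟨x, hxt, hax⟩ := mem_iUnion₂.1 (ht ha)
    have hx := htA x hxt
    refine ⟨U x, hU x hx, hax, fun p hp q hq =>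
      (hsmall x hx p (subset_closure hp) q (subset_closure hq)).trans_le (min_le_right _ _), ?_⟩
    intro b hb hab
    have hdist := hf ((hsmall x hx a (subset_closure hax) b
      (frontier_subset_closure hb)).trans_le (min_le_left _ _))
    rw [Subtype.dist_eq, Real.dist_eq] at hdist
    have hab' : (1 - c) * (f a : ℝ) + c * φ a = (1 - c) * (f b : ℝ) + c * φ b :=
      congrArg Subtype.val hab
    rw [hφ₁ ha, hφ₀ (mem_iUnion₂.2 ⟨x, hxt, hb⟩)] at hab'
    simp only [Pi.one_apply, Pi.zero_apply] at hab'
    nlinarith [abs_lt.1 hdist]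

/-- A fiber component through a point of `A` has no point at distance `ε` or more from it. -/
theorem dist_lt_of_mem_connectedComponentIn {X : Type*} [MetricSpace X] {A : Set X} {ε : ℝ}
    {g : C(X, unitInterval)} (hg : g ∈ mapsWithSmallSeparation A ε) {x z : X} (hx : x ∈ A)
    (hz : z ∈ connectedComponentIn (⇑g ⁻¹' {g x}) x) : dist z x < ε := by
  obtain ⟨U, hU, hxU, hd, hfr⟩ := hg x hx
  have hxC : x ∈ connectedComponentIn (⇑g ⁻¹' {g x}) x := mem_connectedComponentIn rfl
  refine hd z (isPreconnected_connectedComponentIn.subset_left_of_subset_union hU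
    isClosed_closure.isOpen_compl (disjoint_compl_right.mono_left subset_closure)
    (fun w hw => ?_) ⟨x, hxC, hxU⟩ hz) x hxU
  by_contra hwU
  simp only [mem_union, mem_compl_iff, not_or, not_not] at hwU
  have hwfr : w ∈ frontier U := hU.frontier_eq ▸ ⟨hwU.2, hwU.1⟩
  exact hfr w hwfr (connectedComponentIn_subset _ _ hw).symm

theorem trivial_components_residual {X : Type*} [MetricSpace X] [CompactSpace X]
    (A : Set X) (hA : IsClosed A) (hdim : CovDimLE ↥A 0) :
    {g : C(X, unitInterval) | ∀ x ∈ A, connectedComponentIn (⇑g ⁻¹' {g x}) x = {x}} ∈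
      residual C(X, unitInterval) := by
  have h : (⋂ n : ℕ, mapsWithSmallSeparation A (1 / ((n : ℝ) + 1))) ∈
      residual C(X, unitInterval) :=
    countable_iInter_mem.2 fun n => residual_of_dense_open
      (isOpen_mapsWithSmallSeparation hA _)
      (dense_mapsWithSmallSeparation hA hdim Nat.one_div_pos_of_nat)
  refine Filter.mem_of_superset h fun g hg x hx => ?_
  refine Subset.antisymm (fun z hz => ?_) (singleton_subset_iff.2 (mem_connectedComponentIn rfl))
  by_contra hne
  obtain ⟨n, hn⟩ := exists_nat_one_div_lt (dist_pos.2 hne)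
  exact (dist_lt_of_mem_connectedComponentIn (mem_iInter.1 hg n) hx hz).not_gt hn
end
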